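/- Let T be a Calderón–Zygmund operator with normalised standard kernel of Hölder exponent γ, s ∈ ℕ, and let Ψ_s := Σ_{k∈ℤ} (Id − E_k) T_{4·2^{−k}} D_{k+s}. Then for every pair (θ,ζ) ∈ {0,1}^{2n}∖{(0,0)}, Σ_{m∈ℤⁿ} sup_{I∈𝒟} |⟨h^θ_{I∔m}, Ψ_s h^ζ_I⟩| · log(2+|m|) ≤ C (1+s) 2^{−sγ}, with C depending only on n and γ. -/

import Mathlib

open MeasureTheory

noncomputable section

open Classical in
/-- Classical indicator of a proposition. -/
def indR (P : Prop) : ℝ := if P then 1 else 0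

/-- The real sign associated to a boolean. -/
def sgnB (b : Bool) : ℝ := if b then 1 else -1

/-- The `ℓ∞` norm of an integer vector, as a real number. -/
def inorm {n : ℕ} (m : Fin n → ℤ) : ℝ := ‖(fun i => (m i : ℝ) : Fin n → ℝ)‖

/-- The dyadic cube `2^{-k}([0,1)^n + m)` of generation `k` in `ℝ^n` (with the `ℓ∞` metric). -/
def dyadicCube (n : ℕ) (k : ℤ) (m : Fin n → ℤ) : Set (Fin n → ℝ) :=
  {x | ∀ i, (2:ℝ) ^ (-k) * m i ≤ x i ∧ x i < (2:ℝ) ^ (-k) * (m i + 1)}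

/-- The side length `2^{-k}` of a dyadic cube of generation `k`. -/
def sideLen (k : ℤ) : ℝ := (2:ℝ) ^ (-k)

/-- One-dimensional Haar function on the dyadic interval `2^{-k}[m, m+1)`:
the non-cancellative `h⁰` for `η = false`, the cancellative `h¹` for `η = true`. -/
def haar1D (k : ℤ) (m : ℤ) (η : Bool) (t : ℝ) : ℝ :=
  (Real.sqrt ((2:ℝ) ^ (-k)))⁻¹ *
    (if η then
        (Set.Ico ((2:ℝ) ^ (-k) * m) ((2:ℝ) ^ (-k) * (m + 1/2))).indicator 1 t
          - (Set.Ico ((2:ℝ) ^ (-k) * (m + 1/2)) ((2:ℝ) ^ (-k) * (m + 1))).indicator 1 t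
      else (Set.Ico ((2:ℝ) ^ (-k) * m) ((2:ℝ) ^ (-k) * (m + 1))).indicator 1 t)

/-- The Haar function `h^η_I` for the dyadic cube `I` indexed by `(k, m)`. -/
def haarFn (n : ℕ) (k : ℤ) (m : Fin n → ℤ) (η : Fin n → Bool) (x : Fin n → ℝ) : ℝ :=
  ∏ i, haar1D k (m i) (η i) (x i)

/-- The non-cancellative Haar function `h⁰_I = |I|^{-1/2} 1_I`. -/
def haarZero (n : ℕ) (k : ℤ) (m : Fin n → ℤ) : (Fin n → ℝ) → ℝ :=
  haarFn n k m (fun _ => false)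

/-- The pairing `⟨g, f⟩ = ∫ g f dx`. -/
def pairing {n : ℕ} (g f : (Fin n → ℝ) → ℝ) : ℝ := ∫ x, g x * f x

/-- A normalised standard kernel with Hölder exponent `γ` (with respect to the `ℓ∞` metric). -/
structure IsNormalisedKernel (n : ℕ) (γ : ℝ) (K : (Fin n → ℝ) → (Fin n → ℝ) → ℝ) : Prop where
  size : ∀ x y, x ≠ y → |K x y| ≤ dist x y ^ (-(n:ℝ))
  smooth : ∀ x y h, 2 * ‖h‖ < dist x y →
    |K (x + h) y - K x y| + |K x (y + h) - K x y| ≤ ‖h‖ ^ γ * dist x y ^ (-(n:ℝ) - γ)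

/-- The singular integral `Tf(x) = ∫ K(x,y) f(y) dy`. -/
def czIntegral {n : ℕ} (K : (Fin n → ℝ) → (Fin n → ℝ) → ℝ) (f : (Fin n → ℝ) → ℝ)
    (x : Fin n → ℝ) : ℝ := ∫ y, K x y * f y

/-- The truncated singular integral `T_ε f(x) = ∫_{|y-x|>ε} K(x,y) f(y) dy`. -/
def czTrunc {n : ℕ} (K : (Fin n → ℝ) → (Fin n → ℝ) → ℝ) (ε : ℝ) (f : (Fin n → ℝ) → ℝ)
    (x : Fin n → ℝ) : ℝ := ∫ y in {y | ε < dist x y}, K x y * f y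

/-- The dyadic conditional expectation `E_k f`. -/
def dyadicE (n : ℕ) (k : ℤ) (f : (Fin n → ℝ) → ℝ) (x : Fin n → ℝ) : ℝ :=
  (2:ℝ) ^ (k * (n:ℤ)) * ∫ y in dyadicCube n k (fun i => ⌊(2:ℝ) ^ k * x i⌋), f y

/-- The dyadic martingale difference `D_k f = E_{k+1} f - E_k f`. -/
def dyadicD (n : ℕ) (k : ℤ) (f : (Fin n → ℝ) → ℝ) (x : Fin n → ℝ) : ℝ :=
  dyadicE n (k+1) f x - dyadicE n k f x

/-- The centre of the dyadic cube indexed by `(k, m)`. -/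
def cubeCenter (n : ℕ) (k : ℤ) (m : Fin n → ℤ) : Fin n → ℝ :=
  fun i => (2:ℝ) ^ (-k) * (m i + 1/2)

/-- The concentric `c`-fold expansion of the dyadic cube indexed by `(k, m)`. -/
def expandCube (n : ℕ) (k : ℤ) (m : Fin n → ℤ) (c : ℝ) : Set (Fin n → ℝ) :=
  {x | ∀ i, |x i - cubeCenter n k m i| ≤ c * (2:ℝ) ^ (-k) / 2}

/-- The set `Σ_{f,s} = ⋃_k 9Ω_k`, where `Ω_k` is the union of the cubes `I ∈ 𝒟_k` on which
`D_{k+s} f` is not a.e. zero. -/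
def SigmaSet (n : ℕ) (f : (Fin n → ℝ) → ℝ) (s : ℕ) : Set (Fin n → ℝ) :=
  ⋃ (k : ℤ) (m : Fin n → ℤ)
    (_ : ¬ (∀ᵐ x ∂(volume.restrict (dyadicCube n k m)), dyadicD n (k + (s:ℤ)) f x = 0)),
      expandCube n k m 9

/-- The (measure-theoretic) support of a measurable function: the complement of the union of
all balls on which the function vanishes a.e. -/
def suppAE {n : ℕ} (f : (Fin n → ℝ) → ℝ) : Set (Fin n → ℝ) :=
  {x | ∀ r > 0, ¬ (∀ᵐ y ∂(volume.restrict (Metric.ball x r)), f y = 0)}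

/-- The axis-parallel closed cube with centre `c` and side length `ρ`. -/
def cube (n : ℕ) (c : Fin n → ℝ) (ρ : ℝ) : Set (Fin n → ℝ) :=
  {x | ∀ i, |x i - c i| ≤ ρ / 2}

/-- The index of the `s`-th dyadic ancestor `I^{(s)}` of the cube indexed by `(k, m)`
(the ancestor is the cube indexed by `(k - s, ancestorIdx s m)`). -/
def ancestorIdx {n : ℕ} (s : ℕ) (m : Fin n → ℤ) : Fin n → ℤ :=
  fun i => Int.fdiv (m i) (2 ^ s)

/-- The distance between two sets (in the ambient metric). -/
def setDist {α : Type*} [PseudoMetricSpace α] (A B : Set α) : ℝ :=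
  sInf (Set.image2 dist A B)

/-- The operator `Ψ_s = Σ_k (Id - E_k) T_{4·2^{-k}} D_{k+s}`, as a pointwise sum over `k`. -/
def PsiOp (n : ℕ) (K : (Fin n → ℝ) → (Fin n → ℝ) → ℝ) (s : ℕ)
    (f : (Fin n → ℝ) → ℝ) (x : Fin n → ℝ) : ℝ :=
  ∑' k : ℤ,
    (czTrunc K (4 * (2:ℝ) ^ (-k)) (dyadicD n (k + (s:ℤ)) f) x -
      dyadicE n k (czTrunc K (4 * (2:ℝ) ^ (-k)) (dyadicD n (k + (s:ℤ)) f)) x)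

/-! ### Lattice sums -/

lemma rpow_neg_sub_le {β x : ℝ} (hβ : 0 < β) (hx : 1 < x) :
    β * x ^ (-1 - β) ≤ (x - 1) ^ (-β) - x ^ (-β) := by
  have hx0 : 0 < x := by linarith
  have h1 : (x - 1) = x * (1 - 1 / x) := by field_simp
  have hp : 0 < 1 - 1 / x := by
    rw [sub_pos, div_lt_one hx0]; exact hx
  have h2 : 1 + β / x ≤ (1 - 1 / x) ^ (-β) := by
    rw [Real.rpow_def_of_pos hp]
    have := Real.add_one_le_exp (β / x)
    have h3 : Real.log (1 - 1 / x) ≤ -(1 / x) := by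
      have := Real.log_le_sub_one_of_pos hp; linarith
    have h4 : β / x ≤ Real.log (1 - 1 / x) * (-β) := by
      have : β / x = (-(1 / x)) * (-β) := by ring
      rw [this]
      exact mul_le_mul_of_nonpos_right h3 (by linarith)
    have := Real.exp_le_exp.2 h4
    linarith
  rw [h1, Real.mul_rpow hx0.le hp.le]
  have h5 : x ^ (-1 - β) = x ^ (-β) * (1 / x) := by
    rw [show (-1 - β) = (-β) - 1 by ring, Real.rpow_sub_one hx0.ne']; ring
  rw [h5]
  have h6 : 0 < x ^ (-β) := by positivity
  have := mul_le_mul_of_nonneg_left h2 h6.le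
  calc β * (x ^ (-β) * (1 / x)) = x ^ (-β) * (1 + β / x) - x ^ (-β) := by ring
    _ ≤ _ := by linarith

lemma sum_range_shifted_rpow_le {β N : ℝ} (hβ : 0 < β) (hN : 1 ≤ N) (M : ℕ) :
    ∑ i ∈ Finset.range (M + 1), (N + (i : ℝ)) ^ (-1 - β)
      ≤ N ^ (-β) + (1 / β) * (N ^ (-β) - (N + (M : ℝ)) ^ (-β)) := by
  induction M with
  | zero =>
    simp only [zero_add, Finset.range_one, Finset.sum_singleton, Nat.cast_zero, add_zero, sub_self,
      mul_zero]
    exact Real.rpow_le_rpow_of_exponent_le hN (by linarith)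
  | succ M ih =>
    rw [Finset.sum_range_succ]
    have h := rpow_neg_sub_le (x := N + ((M + 1 : ℕ) : ℝ)) hβ (by push_cast; have : (0:ℝ) ≤ M := Nat.cast_nonneg M; linarith)
    have e : N + ((M + 1 : ℕ) : ℝ) - 1 = N + (M : ℝ) := by push_cast; ring
    rw [e] at h
    have h' : (N + ((M + 1 : ℕ) : ℝ)) ^ (-1 - β)
        ≤ (1 / β) * ((N + (M : ℝ)) ^ (-β) - (N + ((M + 1 : ℕ) : ℝ)) ^ (-β)) := by
      rw [one_div, ← div_eq_inv_mul, le_div_iff₀ hβ]; linarith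
    linarith

lemma sum_nat_shifted_rpow_le {β N : ℝ} (hβ : 0 < β) (hN : 1 ≤ N) (S : Finset ℕ) :
    ∑ i ∈ S, (N + (i : ℝ)) ^ (-1 - β) ≤ (1 + 1 / β) * N ^ (-β) := by
  have hN0 : 0 < N := by linarith
  have hsub : S ⊆ Finset.range (S.sup id + 1) := fun i hi =>
    Finset.mem_range.2 (Nat.lt_succ_of_le (Finset.le_sup (f := id) hi))
  refine (Finset.sum_le_sum_of_subset_of_nonneg hsub fun _ _ _ => by positivity).trans ?_
  refine (sum_range_shifted_rpow_le hβ hN _).trans ?_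
  have : 0 ≤ (1 / β) * (N + ((S.sup id : ℕ) : ℝ)) ^ (-β) := by positivity
  linarith

lemma sum_int_shifted_rpow_le {β N : ℝ} (hβ : 0 < β) (hN : 1 ≤ N) (F : Finset ℤ) :
    ∑ j ∈ F, (N + |(j : ℝ)|) ^ (-1 - β) ≤ 2 * (1 + 1 / β) * N ^ (-β) := by
  have key : ∀ G : Finset ℤ, Set.InjOn Int.natAbs (G : Set ℤ) →
      ∑ j ∈ G, (N + |(j : ℝ)|) ^ (-1 - β) ≤ (1 + 1 / β) * N ^ (-β) := by
    intro G hG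
    have := Finset.sum_image (f := fun i : ℕ => (N + (i : ℝ)) ^ (-1 - β)) hG
    simp only [Nat.cast_natAbs, Int.cast_abs] at this
    rw [← this]
    exact sum_nat_shifted_rpow_le hβ hN _
  rw [← Finset.sum_filter_add_sum_filter_not F (fun j => 0 ≤ j)]
  have h1 := key (F.filter fun j => 0 ≤ j) (by
    intro a ha b hb hab
    simp only [Finset.coe_filter, Set.mem_ofPred_eq] at ha hb
    omega)
  have h2 := key (F.filter fun j => ¬ 0 ≤ j) (by
    intro a ha b hb hab
    simp only [Finset.coe_filter, Set.mem_ofPred_eq] at ha hb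
    omega)
  linarith

lemma abs_le_inorm {n : ℕ} (m : Fin n → ℤ) (i : Fin n) : |(m i : ℝ)| ≤ inorm m := by
  have := norm_le_pi_norm (fun i => (m i : ℝ) : Fin n → ℝ) i
  simpa [inorm, Real.norm_eq_abs] using this

lemma inorm_nonneg {n : ℕ} (m : Fin n → ℤ) : 0 ≤ inorm m := norm_nonneg _

lemma exists_abs_eq_inorm {n : ℕ} (hn : 0 < n) (m : Fin n → ℤ) :
    ∃ i, |(m i : ℝ)| = inorm m := by
  have : Nonempty (Fin n) := ⟨⟨0, hn⟩⟩
  obtain ⟨i, -, hi⟩ := Finset.exists_mem_eq_sup' (s := Finset.univ) Finset.univ_nonempty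
    (fun i : Fin n => |(m i : ℝ)|)
  refine ⟨i, le_antisymm (abs_le_inorm m i) ?_⟩
  refine (pi_norm_le_iff_of_nonneg (abs_nonneg _)).2 fun j => ?_
  rw [← hi, Real.norm_eq_abs]
  exact Finset.le_sup' (fun i : Fin n => |(m i : ℝ)|) (Finset.mem_univ j)

lemma sum_shifted_inorm_rpow_le {n : ℕ} (hn : 0 < n) {α N : ℝ} (hα : 0 < α) (hN : 1 ≤ N)
    (F : Finset (Fin n → ℤ)) :
    ∑ m ∈ F, (N + inorm m) ^ (-(n : ℝ) - α) ≤ (2 * (1 + n / α)) ^ n * N ^ (-α) := by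
  have hn' : (0 : ℝ) < n := by exact_mod_cast hn
  have hN0 : 0 < N := by linarith
  set β := α / n with hβ
  have hβ0 : 0 < β := by positivity
  have hpt : ∀ m : Fin n → ℤ, (N + inorm m) ^ (-(n : ℝ) - α)
      ≤ ∏ i, (N + |(m i : ℝ)|) ^ (-1 - β) := by
    intro m
    have hm := inorm_nonneg m
    have : (N + inorm m) ^ (-(n : ℝ) - α) = ∏ _i : Fin n, (N + inorm m) ^ (-1 - β) := by
      rw [Finset.prod_const, Finset.card_univ, Fintype.card_fin, ← Real.rpow_natCast,
        ← Real.rpow_mul (by positivity)]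
      congr 1; rw [hβ]; field_simp
    rw [this]
    refine Finset.prod_le_prod (fun _ _ => by positivity) fun i _ => ?_
    exact Real.rpow_le_rpow_of_nonpos (by positivity) (by linarith [abs_le_inorm m i])
      (by linarith)
  have hsub : F ⊆ Fintype.piFinset fun i => F.image fun m => m i := fun m hm =>
    Fintype.mem_piFinset.2 fun i => Finset.mem_image_of_mem (fun m : Fin n → ℤ => m i) hm
  calc ∑ m ∈ F, (N + inorm m) ^ (-(n : ℝ) - α)
      ≤ ∑ m ∈ F, ∏ i, (N + |(m i : ℝ)|) ^ (-1 - β) := Finset.sum_le_sum fun m _ => hpt m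
    _ ≤ ∑ m ∈ Fintype.piFinset (fun i => (F.image fun m => m i : Finset ℤ)),
          ∏ i, (N + |(m i : ℝ)|) ^ (-1 - β) :=
        Finset.sum_le_sum_of_subset_of_nonneg hsub fun _ _ _ =>
          Finset.prod_nonneg fun _ _ => by positivity
    _ = ∏ i, ∑ j ∈ (F.image fun m => m i : Finset ℤ), (N + |(j : ℝ)|) ^ (-1 - β) :=
        (Finset.prod_univ_sum (fun i => F.image fun m => m i)
          (fun _ (j : ℤ) => (N + |(j : ℝ)|) ^ (-1 - β))).symm
    _ ≤ ∏ _i : Fin n, 2 * (1 + 1 / β) * N ^ (-β) :=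
        Finset.prod_le_prod (fun _ _ => Finset.sum_nonneg fun _ _ => by positivity)
          fun i _ => sum_int_shifted_rpow_le hβ0 hN _
    _ = _ := by
        rw [Finset.prod_const, Finset.card_univ, Fintype.card_fin, mul_pow, ← Real.rpow_natCast
          (N ^ (-β)), ← Real.rpow_mul (by positivity)]
        congr 2
        · rw [hβ]; field_simp
        · rw [hβ]; field_simp

/-- Counting integer points in a thin `ℓ∞` shell. -/
lemma card_shell_le {n : ℕ} (hn : 0 < n) {N U : ℤ} (hU : 1 ≤ U) (hUN : U ≤ N)
    (F : Finset (Fin n → ℤ)) (hF : ∀ m ∈ F, |inorm m - 4 * N| ≤ 3 * (U : ℝ)) :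
    (F.card : ℝ) ≤ (n * 14 * 15 ^ (n - 1) : ℝ) * (N : ℝ) ^ (n - 1) * U := by
  classical
  let S : Finset ℤ := Finset.Icc (4 * N - 3 * U) (4 * N + 3 * U) ∪
    Finset.Icc (-(4 * N + 3 * U)) (-(4 * N - 3 * U))
  let T : Finset ℤ := Finset.Icc (-(7 * N)) (7 * N)
  let P : Fin n → Finset (Fin n → ℤ) := fun i =>
    Fintype.piFinset (Function.update (fun _ => T) i S)
  have hsub : F ⊆ Finset.univ.biUnion P := by
    intro m hm
    have h1 := hF m hm
    obtain ⟨i, hi⟩ := exists_abs_eq_inorm hn m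
    rw [abs_le] at h1
    refine Finset.mem_biUnion.2 ⟨i, Finset.mem_univ _, Fintype.mem_piFinset.2 fun j => ?_⟩
    by_cases hj : j = i
    · subst hj
      rw [Function.update_self]
      rw [← hi] at h1
      have h2 : 4 * N - 3 * U ≤ |m j| ∧ |m j| ≤ 4 * N + 3 * U := by
        constructor
        · have : ((4 * N - 3 * U : ℤ) : ℝ) ≤ ((|m j| : ℤ) : ℝ) := by push_cast; linarith
          exact_mod_cast this
        · have : ((|m j| : ℤ) : ℝ) ≤ ((4 * N + 3 * U : ℤ) : ℝ) := by push_cast; linarith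
          exact_mod_cast this
      simp only [S, Finset.mem_union, Finset.mem_Icc]
      rcases abs_cases (m j) with h | h <;> omega
    · rw [Function.update_of_ne hj]
      have h3 := abs_le_inorm m j
      have h2 : |m j| ≤ 4 * N + 3 * U := by
        have : ((|m j| : ℤ) : ℝ) ≤ ((4 * N + 3 * U : ℤ) : ℝ) := by push_cast; linarith
        exact_mod_cast this
      simp only [T, Finset.mem_Icc]
      rw [abs_le] at h2
      omega
  have hS : (S.card : ℝ) ≤ 14 * U := by
    have h : (S.card : ℤ) ≤ 14 * U := by
      have := Finset.card_union_le (Finset.Icc (4 * N - 3 * U) (4 * N + 3 * U))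
        (Finset.Icc (-(4 * N + 3 * U)) (-(4 * N - 3 * U)))
      simp only [Int.card_Icc] at this
      change ((Finset.card (_ ∪ _) : ℕ) : ℤ) ≤ _
      omega
    exact_mod_cast h
  have hT : (T.card : ℝ) ≤ 15 * N := by
    have h : (T.card : ℤ) ≤ 15 * N := by
      simp only [T, Int.card_Icc]
      omega
    exact_mod_cast h
  have hP : ∀ i, ((P i).card : ℝ) ≤ 14 * U * (15 * N) ^ (n - 1) := by
    intro i
    simp only [P]
    rw [Fintype.card_piFinset, Nat.cast_prod,
      ← Finset.mul_prod_erase Finset.univ _ (Finset.mem_univ i), Function.update_self]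
    have : ∏ x ∈ Finset.univ.erase i, ((Function.update (fun _ => T) i S x).card : ℝ)
        = (T.card : ℝ) ^ (n - 1) := by
      rw [Finset.prod_congr rfl (g := fun _ => (T.card : ℝ))]
      · simp
      · intro x hx
        rw [Function.update_of_ne (Finset.ne_of_mem_erase hx)]
    rw [this]
    have hU0 : (0 : ℝ) ≤ U := by exact_mod_cast (by omega : 0 ≤ U)
    gcongr
  calc (F.card : ℝ) ≤ ((Finset.univ.biUnion P).card : ℝ) := by
        exact_mod_cast Finset.card_le_card hsub
    _ ≤ ∑ i, ((P i).card : ℝ) := by exact_mod_cast Finset.card_biUnion_le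
    _ ≤ ∑ _i : Fin n, 14 * U * (15 * N : ℝ) ^ (n - 1) := Finset.sum_le_sum fun i _ => hP i
    _ = _ := by
        rw [Finset.sum_const, Finset.card_univ, Fintype.card_fin, nsmul_eq_mul, mul_pow]
        ring

/-- The decay profile, at relative position `m`, of a Haar coefficient coming from the
truncation radius `4 · 2^v` and the averaging scale `2^u`: a decaying tail, plus the
contribution of the sphere where the truncation is discontinuous. -/
def coeffBd (n : ℕ) (γ : ℝ) (u v : ℕ) (m : Fin n → ℤ) : ℝ :=
  ((2:ℝ) ^ v + inorm m) ^ (-(n:ℝ) - γ) +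
    open Classical in
    if |inorm m - 4 * (2:ℝ) ^ v| ≤ 3 * (2:ℝ) ^ u then (((2:ℝ) ^ v) ^ n * (2:ℝ) ^ u)⁻¹ else 0

lemma coeffBd_nonneg (n : ℕ) (γ : ℝ) (u v : ℕ) (m : Fin n → ℤ) : 0 ≤ coeffBd n γ u v m := by
  have := inorm_nonneg m
  unfold coeffBd
  split_ifs <;> positivity

lemma log_two_add_le {γ r : ℝ} (hγ : 0 < γ) (hr : 0 ≤ r) (v : ℕ) :
    Real.log (2 + r) ≤ (1 + 2 / γ) * (1 + v) * (((2:ℝ) ^ v + r) / (2:ℝ) ^ v) ^ (γ / 2) := by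
  set N : ℝ := (2:ℝ) ^ v with hN
  have hN1 : 1 ≤ N := one_le_pow₀ (by norm_num)
  have hN0 : 0 < N := by linarith
  set X := (N + r) / N with hX
  have hX1 : 1 ≤ X := by rw [hX, le_div_iff₀ hN0]; linarith
  have hY : 1 ≤ X ^ (γ / 2) := Real.one_le_rpow hX1 (by positivity)
  have h1 : Real.log (2 + r) ≤ Real.log ((2:ℝ) ^ (v + 1) * X) := by
    apply Real.log_le_log (by positivity)
    have : (2:ℝ) ^ (v + 1) * X = 2 * (N + r) := by rw [pow_succ, hX, hN]; field_simp
    rw [this]; linarith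
  rw [Real.log_mul (by positivity) (by positivity), Real.log_pow] at h1
  have h2 : Real.log X ≤ X ^ (γ / 2) / (γ / 2) := Real.log_le_rpow_div (by positivity) (by positivity)
  have h3 : Real.log 2 ≤ 1 := by linarith [Real.log_two_lt_d9]
  have hv : (0:ℝ) ≤ v := Nat.cast_nonneg v
  have h4 : ((v + 1 : ℕ) : ℝ) * Real.log 2 ≤ 1 + v := by
    push_cast; nlinarith
  have h5 : X ^ (γ / 2) / (γ / 2) = 2 / γ * X ^ (γ / 2) := by field_simp
  have h6 : 0 ≤ 2 / γ * X ^ (γ / 2) := by positivity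
  calc Real.log (2 + r) ≤ (1 + v) + 2 / γ * X ^ (γ / 2) := by linarith
    _ ≤ (1 + v) * X ^ (γ / 2) + (1 + v) * (2 / γ * X ^ (γ / 2)) := by
        exact add_le_add (le_mul_of_one_le_right (by positivity) hY)
          (le_mul_of_one_le_left h6 (by linarith))
    _ = _ := by ring

lemma sum_coeffBd_log_le {n : ℕ} (hn : 0 < n) {γ : ℝ} (hγ0 : 0 < γ) (hγ1 : γ ≤ 1) :
    ∃ C : ℝ, 0 < C ∧ ∀ u v : ℕ, u ≤ v → ∀ F : Finset (Fin n → ℤ),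
      ∑ m ∈ F, coeffBd n γ u v m * Real.log (2 + inorm m) ≤
        C * ((1 + v) * ((2:ℝ) ^ v) ^ (-γ)) := by
  classical
  set C₁ : ℝ := (2 * (1 + n / (γ / 2))) ^ n with hC₁
  set C₂ : ℝ := n * 14 * 15 ^ (n - 1) with hC₂
  refine ⟨(1 + 2 / γ) * (C₁ + 8 * C₂), by positivity, fun u v huv F => ?_⟩
  set N : ℝ := (2:ℝ) ^ v with hN
  set U : ℝ := (2:ℝ) ^ u with hU
  have hN1 : 1 ≤ N := one_le_pow₀ (by norm_num)
  have hN0 : 0 < N := by linarith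
  have hU0 : 0 < U := by positivity
  let P : (Fin n → ℤ) → Prop := fun m => |inorm m - 4 * N| ≤ 3 * U
  have hpt : ∀ m : Fin n → ℤ, coeffBd n γ u v m * Real.log (2 + inorm m) ≤
      (1 + 2 / γ) * (1 + v) * (N ^ (-(γ / 2)) * (N + inorm m) ^ (-(n:ℝ) - γ / 2) +
        if P m then 8 * (N ^ n * U)⁻¹ else 0) := by
    intro m
    have hr := inorm_nonneg m
    have hlog := log_two_add_le hγ0 hr v
    rw [← hN] at hlog
    refine (mul_le_mul_of_nonneg_left hlog (coeffBd_nonneg _ _ _ _ _)).trans ?_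
    set X := (N + inorm m) / N with hX
    have hX0 : 0 ≤ X := by positivity
    have e1 : (N + inorm m) ^ (-(n:ℝ) - γ) * X ^ (γ / 2)
        = N ^ (-(γ / 2)) * (N + inorm m) ^ (-(n:ℝ) - γ / 2) := by
      rw [hX, Real.div_rpow (by positivity) (by positivity), Real.rpow_neg (by positivity),
        show -(n:ℝ) - γ / 2 = (-(n:ℝ) - γ) + γ / 2 by ring, Real.rpow_add (by positivity)]
      field_simp
    have e2 : (if P m then (N ^ n * U)⁻¹ else 0) * X ^ (γ / 2)
        ≤ if P m then 8 * (N ^ n * U)⁻¹ else 0 := by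
      split_ifs with h
      · have h' : inorm m ≤ 7 * N := by
          have := (abs_le.1 h).2
          have : U ≤ N := pow_le_pow_right₀ (by norm_num) huv
          linarith
        have hX8 : X ≤ 8 := by rw [hX, div_le_iff₀ hN0]; linarith
        have : X ^ (γ / 2) ≤ 8 := by
          calc X ^ (γ / 2) ≤ 8 ^ (γ / 2) := Real.rpow_le_rpow hX0 hX8 (by positivity)
            _ ≤ 8 ^ (1:ℝ) := Real.rpow_le_rpow_of_exponent_le (by norm_num) (by linarith)
            _ = 8 := by norm_num
        rw [mul_comm]
        gcongr
      · simp
    calc coeffBd n γ u v m * ((1 + 2 / γ) * (1 + v) * X ^ (γ / 2))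
        = (1 + 2 / γ) * (1 + v) * ((N + inorm m) ^ (-(n:ℝ) - γ) * X ^ (γ / 2) +
          (if P m then (N ^ n * U)⁻¹ else 0) * X ^ (γ / 2)) := by
          unfold coeffBd
          simp only [P, ← hN, ← hU]
          ring
      _ ≤ _ := by
          rw [e1]
          gcongr
  have hcard : (((F.filter P).card : ℕ) : ℝ) ≤ C₂ * N ^ (n - 1) * U := by
    have := card_shell_le hn (N := 2 ^ v) (U := 2 ^ u) (one_le_pow₀ (by norm_num))
      (pow_le_pow_right₀ (by norm_num) huv) (F.filter P) (by
        intro m hm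
        have := (Finset.mem_filter.1 hm).2
        push_cast
        exact this)
    push_cast at this
    exact this
  have hs := sum_shifted_inorm_rpow_le hn (α := γ / 2) (by positivity) hN1 F
  have hγN : N ^ (-(γ / 2)) * N ^ (-(γ / 2)) = N ^ (-γ) := by
    rw [← Real.rpow_add hN0]; congr 1; ring
  have hN1γ : N⁻¹ ≤ N ^ (-γ) := by
    rw [← Real.rpow_neg_one]
    exact Real.rpow_le_rpow_of_exponent_le hN1 (by linarith)
  calc ∑ m ∈ F, coeffBd n γ u v m * Real.log (2 + inorm m)
      ≤ ∑ m ∈ F, (1 + 2 / γ) * (1 + v) * (N ^ (-(γ / 2)) * (N + inorm m) ^ (-(n:ℝ) - γ / 2) +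
        if P m then 8 * (N ^ n * U)⁻¹ else 0) := Finset.sum_le_sum fun m _ => hpt m
    _ = (1 + 2 / γ) * (1 + v) * (N ^ (-(γ / 2)) * ∑ m ∈ F, (N + inorm m) ^ (-(n:ℝ) - γ / 2) +
        (F.filter P).card * (8 * (N ^ n * U)⁻¹)) := by
        rw [← Finset.mul_sum, Finset.sum_add_distrib, ← Finset.mul_sum, ← Finset.sum_filter,
          Finset.sum_const, nsmul_eq_mul]
    _ ≤ (1 + 2 / γ) * (1 + v) * (N ^ (-(γ / 2)) * (C₁ * N ^ (-(γ / 2))) +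
        (C₂ * N ^ (n - 1) * U) * (8 * (N ^ n * U)⁻¹)) := by
        gcongr
    _ = (1 + 2 / γ) * (1 + v) * (C₁ * (N ^ (-(γ / 2)) * N ^ (-(γ / 2))) + 8 * C₂ * N⁻¹) := by
        have : N ^ n = N ^ (n - 1) * N := by rw [← pow_succ, Nat.sub_add_cancel hn]
        rw [this]
        field_simp
    _ ≤ (1 + 2 / γ) * (1 + v) * (C₁ * N ^ (-γ) + 8 * C₂ * N ^ (-γ)) := by
        rw [hγN]
        gcongr
    _ = _ := by ring

/-! ### Truncated kernels -/

open Classical in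
/-- The kernel of the truncated singular integral. -/
def truncKernel {n : ℕ} (K : (Fin n → ℝ) → (Fin n → ℝ) → ℝ) (R : ℝ) (x y : Fin n → ℝ) : ℝ :=
  if R < dist x y then K x y else 0

open Classical in
/-- The bound for the oscillation at scale `δ` of a kernel truncated at radius `R`, at
distance `r` from the diagonal. -/
def oscBd (n : ℕ) (γ δ R r : ℝ) : ℝ :=
  (if R < r then δ ^ γ * r ^ (-(n:ℝ) - γ) else 0) + (if |r - R| ≤ δ then (R ^ n)⁻¹ else 0)

lemma oscBd_nonneg (n : ℕ) (γ : ℝ) {δ R r : ℝ} (hδ : 0 < δ) (hR : 0 < R) :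
    0 ≤ oscBd n γ δ R r := by
  unfold oscBd
  apply add_nonneg
  · split_ifs with h
    · have : 0 < r := hR.trans h
      positivity
    · rfl
  · split_ifs <;> positivity

lemma measurable_oscBd (n : ℕ) (γ δ R : ℝ) : Measurable (oscBd n γ δ R) := by
  unfold oscBd
  refine Measurable.add (Measurable.ite (measurableSet_lt measurable_const measurable_id) ?_
    measurable_const) (Measurable.ite (measurableSet_le ?_ measurable_const) measurable_const
    measurable_const) <;> fun_prop

lemma oscBd_le {n : ℕ} {γ δ R r : ℝ} (hγ : 0 < γ) (hδ : 0 < δ) (hR : 0 < R) :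
    oscBd n γ δ R r ≤ δ ^ γ * R ^ (-(n:ℝ) - γ) + (R ^ n)⁻¹ := by
  unfold oscBd
  apply add_le_add
  · split_ifs with h
    · have hn : (0:ℝ) ≤ n := Nat.cast_nonneg n
      exact mul_le_mul_of_nonneg_left (Real.rpow_le_rpow_of_nonpos hR h.le (by linarith))
        (by positivity)
    · positivity
  · split_ifs
    · exact le_rfl
    · positivity

lemma IsNormalisedKernel.flip {n : ℕ} {γ : ℝ} {K : (Fin n → ℝ) → (Fin n → ℝ) → ℝ}
    (hK : IsNormalisedKernel n γ K) : IsNormalisedKernel n γ (fun x y => K y x) where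
  size x y h := by simpa only [dist_comm] using hK.size y x h.symm
  smooth x y h hh := by
    rw [add_comm, dist_comm x y]
    exact hK.smooth y x h (by rwa [dist_comm])

lemma truncKernel_flip {n : ℕ} (K : (Fin n → ℝ) → (Fin n → ℝ) → ℝ) (R : ℝ) (x y : Fin n → ℝ) :
    truncKernel (fun x y => K y x) R y x = truncKernel K R x y := by
  simp only [truncKernel, dist_comm]

lemma czTrunc_eq_integral {n : ℕ} (K : (Fin n → ℝ) → (Fin n → ℝ) → ℝ) (R : ℝ)
    (f : (Fin n → ℝ) → ℝ) (x : Fin n → ℝ) :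
    czTrunc K R f x = ∫ y, truncKernel K R x y * f y := by
  unfold czTrunc
  rw [← integral_indicator (measurableSet_lt measurable_const (by fun_prop))]
  congr 1 with y
  simp only [Set.indicator_apply, Set.mem_ofPred_eq, truncKernel, ite_mul, zero_mul]

lemma abs_truncKernel_le {n : ℕ} {γ : ℝ} {K : (Fin n → ℝ) → (Fin n → ℝ) → ℝ}
    (hK : IsNormalisedKernel n γ K) {R : ℝ} (hR : 0 < R) (x y : Fin n → ℝ) :
    |truncKernel K R x y| ≤ (R ^ n)⁻¹ := by
  unfold truncKernel
  split_ifs with h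
  · have hne : x ≠ y := dist_pos.1 (hR.trans h)
    refine (hK.size x y hne).trans ?_
    rw [Real.rpow_neg dist_nonneg, Real.rpow_natCast]
    gcongr
  · simp only [abs_zero]; positivity

lemma abs_truncKernel_sub_le {n : ℕ} {γ : ℝ} {K : (Fin n → ℝ) → (Fin n → ℝ) → ℝ}
    (hK : IsNormalisedKernel n γ K) (hγ : 0 < γ) {R δ : ℝ} (hδ : 0 < δ) (hR : 4 * δ ≤ R)
    {x x₀ : Fin n → ℝ} (hx : dist x x₀ ≤ δ) (y : Fin n → ℝ) :
    |truncKernel K R x y - truncKernel K R x₀ y| ≤ oscBd n γ δ R (dist x₀ y) := by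
  have hR0 : 0 < R := by linarith
  have hd : |dist x y - dist x₀ y| ≤ δ := (abs_dist_sub_le x x₀ y).trans hx
  rw [abs_le] at hd
  have hbd := abs_truncKernel_le hK hR0
  have hx' : ‖x - x₀‖ ≤ δ := by rwa [← dist_eq_norm]
  by_cases h0 : R < dist x₀ y
  · by_cases h1 : R < dist x y
    · have hs := hK.smooth x₀ y (x - x₀) (by linarith)
      rw [add_sub_cancel] at hs
      have h2 : |K x y - K x₀ y| ≤ δ ^ γ * dist x₀ y ^ (-(n:ℝ) - γ) := by
        have h3 : ‖x - x₀‖ ^ γ ≤ δ ^ γ := Real.rpow_le_rpow (norm_nonneg _) hx' hγ.le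
        have h4 : 0 ≤ dist x₀ y ^ (-(n:ℝ) - γ) := Real.rpow_nonneg dist_nonneg _
        have h5 := abs_nonneg (K x₀ (y + (x - x₀)) - K x₀ y)
        have h6 := mul_le_mul_of_nonneg_right h3 h4
        linarith
      unfold oscBd
      simp only [truncKernel, h0, h1, if_true]
      have : (0:ℝ) ≤ if |dist x₀ y - R| ≤ δ then (R ^ n)⁻¹ else 0 := by
        split_ifs <;> positivity
      linarith
    · have e : truncKernel K R x y = 0 := by simp [truncKernel, h1]
      rw [e, zero_sub, abs_neg]
      refine (hbd x₀ y).trans ?_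
      unfold oscBd
      rw [if_pos h0, if_pos (by rw [abs_le]; constructor <;> linarith)]
      have : 0 ≤ δ ^ γ * dist x₀ y ^ (-(n:ℝ) - γ) := by positivity
      linarith
  · have e : truncKernel K R x₀ y = 0 := by simp [truncKernel, h0]
    rw [e, sub_zero]
    by_cases h1 : R < dist x y
    · refine (hbd x y).trans ?_
      unfold oscBd
      rw [if_neg h0, if_pos (by rw [abs_le]; constructor <;> linarith), zero_add]
    · have e : truncKernel K R x y = 0 := by simp [truncKernel, h1]
      rw [e, abs_zero]
      exact oscBd_nonneg n γ hδ hR0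

lemma measurable_truncKernel {n : ℕ} {γ : ℝ} {K : (Fin n → ℝ) → (Fin n → ℝ) → ℝ}
    (hK : IsNormalisedKernel n γ K) (hγ : 0 < γ) {R : ℝ} (hR : 0 < R) (x : Fin n → ℝ) :
    Measurable (truncKernel K R x) := by
  classical
  have hcont : ContinuousOn (K x) {y | R < dist x y} := by
    intro y hy
    apply ContinuousAt.continuousWithinAt
    have hd : 0 < dist x y := hR.trans hy
    rw [ContinuousAt, tendsto_iff_norm_sub_tendsto_zero]
    have hlim : Filter.Tendsto (fun z => ‖z - y‖ ^ γ * dist x y ^ (-(n:ℝ) - γ)) (nhds y)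
        (nhds 0) := by
      have h1 : Filter.Tendsto (fun z : Fin n → ℝ => ‖z - y‖) (nhds y) (nhds 0) :=
        tendsto_iff_norm_sub_tendsto_zero.1 Filter.tendsto_id
      have h2 := h1.rpow_const (p := γ) (Or.inr hγ.le)
      rw [Real.zero_rpow hγ.ne'] at h2
      simpa using h2.mul_const (dist x y ^ (-(n:ℝ) - γ))
    refine squeeze_zero' (Filter.Eventually.of_forall fun _ => norm_nonneg _) ?_ hlim
    filter_upwards [Metric.ball_mem_nhds y (half_pos hd)] with z hz
    rw [Metric.mem_ball, dist_eq_norm] at hz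
    have hs := hK.smooth x y (z - y) (by linarith)
    rw [add_sub_cancel y z] at hs
    rw [Real.norm_eq_abs]
    linarith [abs_nonneg (K (x + (z - y)) y - K x y)]
  have hm := ContinuousOn.measurable_piecewise hcont
    (continuousOn_const (c := (0:ℝ)) (s := {y | R < dist x y}ᶜ))
    (measurableSet_lt measurable_const (by fun_prop))
  have e : truncKernel K R x = Set.piecewise {y | R < dist x y} (K x) fun _ => 0 := by
    funext y
    by_cases h : R < dist x y <;> simp [truncKernel, h]
  rwa [e]

lemma integrable_truncKernel_mul {n : ℕ} {γ : ℝ} {K : (Fin n → ℝ) → (Fin n → ℝ) → ℝ}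
    (hK : IsNormalisedKernel n γ K) (hγ : 0 < γ) {R : ℝ} (hR : 0 < R) (x : Fin n → ℝ)
    {f : (Fin n → ℝ) → ℝ} (hf : Integrable f) :
    Integrable fun y => truncKernel K R x y * f y :=
  hf.bdd_mul (c := (R ^ n)⁻¹) (measurable_truncKernel hK hγ hR x).aestronglyMeasurable
    (Filter.Eventually.of_forall fun y => abs_truncKernel_le hK hR x y)

/-- Oscillation of `T_R f` at scale `δ`. -/
lemma abs_czTrunc_sub_le {n : ℕ} {γ : ℝ} {K : (Fin n → ℝ) → (Fin n → ℝ) → ℝ}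
    (hK : IsNormalisedKernel n γ K) (hγ : 0 < γ) {R δ : ℝ} (hδ : 0 < δ) (hR : 4 * δ ≤ R)
    {x x₀ : Fin n → ℝ} (hx : dist x x₀ ≤ δ) {f : (Fin n → ℝ) → ℝ} (hf : Integrable f) :
    |czTrunc K R f x - czTrunc K R f x₀| ≤ ∫ y, oscBd n γ δ R (dist x₀ y) * |f y| := by
  have hR0 : 0 < R := by linarith
  rw [czTrunc_eq_integral, czTrunc_eq_integral, ← integral_sub
    (integrable_truncKernel_mul hK hγ hR0 x hf) (integrable_truncKernel_mul hK hγ hR0 x₀ hf)]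
  rw [← Real.norm_eq_abs]
  refine norm_integral_le_of_norm_le ?_ (Filter.Eventually.of_forall
    fun y => ?_)
  · refine hf.abs.bdd_mul (c := δ ^ γ * R ^ (-(n:ℝ) - γ) + (R ^ n)⁻¹)
      ((measurable_oscBd n γ δ R).comp (by fun_prop)).aestronglyMeasurable
      (Filter.Eventually.of_forall fun y => ?_)
    rw [Real.norm_eq_abs, abs_of_nonneg (oscBd_nonneg n γ hδ hR0)]
    exact oscBd_le hγ hδ hR0
  · rw [← sub_mul, Real.norm_eq_abs, abs_mul]
    exact mul_le_mul_of_nonneg_right (abs_truncKernel_sub_le hK hγ hδ hR hx y) (abs_nonneg _)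

/-- Size of `T_R f` when `f` has mean zero and is supported within `δ` of `c`. -/
lemma abs_czTrunc_le_of_integral_eq_zero {n : ℕ} {γ : ℝ}
    {K : (Fin n → ℝ) → (Fin n → ℝ) → ℝ}
    (hK : IsNormalisedKernel n γ K) (hγ : 0 < γ) {R δ : ℝ} (hδ : 0 < δ) (hR : 4 * δ ≤ R)
    {f : (Fin n → ℝ) → ℝ} (hf : Integrable f) (hf0 : ∫ y, f y = 0) {c : Fin n → ℝ}
    (hfc : ∀ y, f y ≠ 0 → dist y c ≤ δ) (x : Fin n → ℝ) :
    |czTrunc K R f x| ≤ oscBd n γ δ R (dist c x) * ∫ y, |f y| := by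
  have hR0 : 0 < R := by linarith
  have e : czTrunc K R f x = ∫ y, (truncKernel K R x y - truncKernel K R x c) * f y := by
    simp only [sub_mul]
    rw [integral_sub (integrable_truncKernel_mul hK hγ hR0 x hf) (hf.const_mul _),
      integral_const_mul, hf0, mul_zero, sub_zero, czTrunc_eq_integral]
  rw [e, ← integral_const_mul, ← Real.norm_eq_abs]
  refine norm_integral_le_of_norm_le (hf.abs.const_mul _) (Filter.Eventually.of_forall
    fun y => ?_)
  rw [Real.norm_eq_abs, abs_mul]
  by_cases hy : f y = 0
  · simp [hy]
  · refine mul_le_mul_of_nonneg_right ?_ (abs_nonneg _)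
    rw [← truncKernel_flip K R x y, ← truncKernel_flip K R x c]
    exact abs_truncKernel_sub_le hK.flip hγ hδ hR (hfc y hy) x

/-! ### Integrals of the oscillation bound -/

lemma volume_real_shell_le {n : ℕ} (hn : 0 < n) (p q : Fin n → ℝ) {r δ R : ℝ} (hr : 0 ≤ r)
    (hδ : 0 ≤ δ) :
    volume.real (Metric.closedBall q r ∩ {y | |dist p y - R| ≤ δ})
      ≤ 4 * n * δ * (2 * r) ^ (n - 1) := by
  classical
  let B : ℝ → Fin n → Set (Fin n → ℝ) := fun σ i =>
    Set.Icc (Function.update (fun j => q j - r) i (p i + σ - δ))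
      (Function.update (fun j => q j + r) i (p i + σ + δ))
  have hB : ∀ σ i, volume.real (B σ i) = 2 * δ * (2 * r) ^ (n - 1) := by
    intro σ i
    simp only [B, Measure.real, Real.volume_Icc_pi]
    rw [ENNReal.toReal_prod, ← Finset.mul_prod_erase Finset.univ _ (Finset.mem_univ i),
      Finset.prod_congr rfl (g := fun _ => 2 * r)]
    · simp only [Function.update_self, Finset.prod_const, Finset.mem_univ,
        Finset.card_erase_of_mem, Finset.card_univ, Fintype.card_fin]
      rw [ENNReal.toReal_ofReal (by linarith)]
      ring
    · intro j hj
      rw [Function.update_of_ne (Finset.ne_of_mem_erase hj),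
        Function.update_of_ne (Finset.ne_of_mem_erase hj), ENNReal.toReal_ofReal (by linarith)]
      ring
  have hsub : Metric.closedBall q r ∩ {y | |dist p y - R| ≤ δ} ⊆
      ⋃ i ∈ (Finset.univ : Finset (Fin n)), (B R i ∪ B (-R) i) := by
    rintro y ⟨hy, hs⟩
    have : Nonempty (Fin n) := ⟨⟨0, hn⟩⟩
    obtain ⟨i, hi⟩ : ∃ i, dist p y = |p i - y i| := by
      obtain ⟨i, -, hi⟩ := Finset.exists_mem_eq_sup' (s := Finset.univ) Finset.univ_nonempty
        (fun i : Fin n => dist (p i) (y i))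
      refine ⟨i, ?_⟩
      rw [← Real.dist_eq]
      refine le_antisymm ((dist_pi_le_iff dist_nonneg).2 fun j => ?_) (dist_le_pi_dist p y i)
      rw [← hi]
      exact Finset.le_sup' (fun i : Fin n => dist (p i) (y i)) (Finset.mem_univ j)
    have hy' : ∀ j, q j - r ≤ y j ∧ y j ≤ q j + r := by
      intro j
      have := (dist_le_pi_dist y q j).trans (Metric.mem_closedBall.1 hy)
      rw [Real.dist_eq, abs_le] at this
      constructor <;> linarith [this.1, this.2]
    rw [Set.mem_ofPred_eq, hi, abs_le] at hs
    refine Set.mem_iUnion₂.2 ⟨i, Finset.mem_univ _, ?_⟩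
    have key : ∀ σ, p i + σ - δ ≤ y i → y i ≤ p i + σ + δ → y ∈ B σ i := by
      intro σ h1 h2
      refine ⟨fun j => ?_, fun j => ?_⟩ <;> by_cases hj : j = i
      · subst hj; simpa using h1
      · rw [Function.update_of_ne hj]; exact (hy' j).1
      · subst hj; simpa using h2
      · rw [Function.update_of_ne hj]; exact (hy' j).2
    rcases abs_cases (p i - y i) with ⟨h, -⟩ | ⟨h, -⟩ <;> rw [h] at hs
    · right; apply key <;> linarith
    · left; apply key <;> linarith
  have hfin : volume (⋃ i ∈ (Finset.univ : Finset (Fin n)), (B R i ∪ B (-R) i)) ≠ ⊤ := by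
    refine ((measure_biUnion_finset_le _ _).trans_lt (ENNReal.sum_lt_top.2 fun i _ => ?_)).ne
    refine (measure_union_le _ _).trans_lt (ENNReal.add_lt_top.2 ⟨?_, ?_⟩) <;>
      exact isCompact_Icc.measure_lt_top
  calc volume.real (Metric.closedBall q r ∩ {y | |dist p y - R| ≤ δ})
      ≤ volume.real (⋃ i ∈ (Finset.univ : Finset (Fin n)), (B R i ∪ B (-R) i)) :=
        measureReal_mono hsub hfin
    _ ≤ ∑ i, volume.real (B R i ∪ B (-R) i) := measureReal_biUnion_finset_le _ _
    _ ≤ ∑ _i : Fin n, (2 * δ * (2 * r) ^ (n - 1) + 2 * δ * (2 * r) ^ (n - 1)) :=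
        Finset.sum_le_sum fun i _ => by
          rw [← hB R i]
          nth_rw 2 [hB R i]
          rw [← hB (-R) i]
          exact measureReal_union_le _ _
    _ = _ := by
        rw [Finset.sum_const, Finset.card_univ, Fintype.card_fin, nsmul_eq_mul]
        ring

lemma volume_real_closedBall {n : ℕ} (q : Fin n → ℝ) {r : ℝ} (hr : 0 ≤ r) :
    volume.real (Metric.closedBall q r) = (2 * r) ^ n := by
  rw [Measure.real, Real.volume_pi_closedBall q hr, ENNReal.toReal_ofReal (by positivity),
    Fintype.card_fin]

lemma integrableOn_oscBd {n : ℕ} {γ δ R : ℝ} (hγ : 0 < γ) (hδ : 0 < δ) (hR : 0 < R)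
    (p : Fin n → ℝ) {S : Set (Fin n → ℝ)} (hS : volume S ≠ ⊤) :
    IntegrableOn (fun y => oscBd n γ δ R (dist p y)) S := by
  refine Measure.integrableOn_of_bounded (M := δ ^ γ * R ^ (-(n:ℝ) - γ) + (R ^ n)⁻¹) hS
    ((measurable_oscBd n γ δ R).comp (by fun_prop)).aestronglyMeasurable
    (Filter.Eventually.of_forall fun y => ?_)
  rw [Real.norm_eq_abs, abs_of_nonneg (oscBd_nonneg n γ hδ hR)]
  exact oscBd_le hγ hδ hR

lemma setIntegral_oscBd_le {n : ℕ} (hn : 0 < n) {γ : ℝ} (hγ0 : 0 < γ) (hγ1 : γ ≤ 1) {δ : ℝ}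
    (hδ : 0 < δ) {u v : ℕ} (huv : u ≤ v) {m : Fin n → ℤ} {p q : Fin n → ℝ}
    (hpq : dist p q = δ * inorm m) :
    ∫ y in Metric.closedBall q (2 * 2 ^ u * δ), oscBd n γ δ (4 * (2 ^ v * δ)) (dist p y)
      ≤ (4 ^ n * 3 ^ (n + 1) + n) * ((2:ℝ) ^ u) ^ n * coeffBd n γ u v m := by
  classical
  set N : ℝ := (2:ℝ) ^ v with hN
  set U : ℝ := (2:ℝ) ^ u with hU
  have hU1 : 1 ≤ U := one_le_pow₀ (by norm_num)
  have hUN : U ≤ N := pow_le_pow_right₀ (by norm_num) huv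
  have hm := inorm_nonneg m
  set R : ℝ := 4 * (N * δ) with hR
  have hR0 : 0 < R := by positivity
  set D : Set (Fin n → ℝ) := Metric.closedBall q (2 * U * δ) with hD
  set S : Set (Fin n → ℝ) := {y | |dist p y - R| ≤ δ} with hS
  have hSm : MeasurableSet S := measurableSet_le (by fun_prop) measurable_const
  have hDm : MeasurableSet D := Metric.isClosed_closedBall.measurableSet
  have hDfin : volume D ≠ ⊤ := (isCompact_closedBall _ _).measure_lt_top.ne
  set W : ℝ := δ / 3 * (N + inorm m) with hW
  have hW0 : 0 < W := by positivity
  have hdist : ∀ y ∈ D, dist p y ≤ δ * inorm m + 2 * U * δ ∧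
      δ * inorm m - 2 * U * δ ≤ dist p y := by
    intro y hy
    have h1 := Metric.mem_closedBall.1 hy
    have h2 := dist_triangle p q y
    have h3 := dist_triangle p y q
    rw [dist_comm q y] at h2
    constructor <;> linarith
  have hUδ : U * δ ≤ N * δ := by gcongr
  have hpt : ∀ y ∈ D, oscBd n γ δ R (dist p y) ≤
      δ ^ γ * W ^ (-(n:ℝ) - γ) + S.indicator (fun _ => (R ^ n)⁻¹) y := by
    intro y hy
    unfold oscBd
    apply add_le_add
    · split_ifs with h
      · have hn' : (0:ℝ) ≤ n := Nat.cast_nonneg n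
        refine mul_le_mul_of_nonneg_left (Real.rpow_le_rpow_of_nonpos hW0 ?_ (by linarith))
          (by positivity)
        have := (hdist y hy).2
        rw [hW]
        rw [hR] at h
        linarith
      · positivity
    · simp only [Set.indicator_apply, hS, Set.mem_ofPred_eq]
      exact le_rfl
  have hvolS : volume.real (D ∩ S) ≤ 4 * n * δ * (2 * (2 * U * δ)) ^ (n - 1) :=
    volume_real_shell_le hn p q (by positivity) hδ.le
  have hint : IntegrableOn (S.indicator fun _ => (R ^ n)⁻¹) D :=
    (integrableOn_const hDfin).indicator hSm
  have hconst : Integrable (fun _ => δ ^ γ * W ^ (-(n:ℝ) - γ)) (volume.restrict D) :=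
    integrableOn_const hDfin
  have hsplit : ∫ y in D, oscBd n γ δ R (dist p y) ≤
      (2 * (2 * U * δ)) ^ n * (δ ^ γ * W ^ (-(n:ℝ) - γ)) + volume.real (D ∩ S) * (R ^ n)⁻¹ := by
    calc ∫ y in D, oscBd n γ δ R (dist p y)
        ≤ ∫ y in D, (δ ^ γ * W ^ (-(n:ℝ) - γ) + S.indicator (fun _ => (R ^ n)⁻¹) y) :=
          setIntegral_mono_on (integrableOn_oscBd hγ0 hδ hR0 p hDfin)
            (hconst.add hint) hDm hpt
      _ = _ := by
          rw [integral_add hconst hint, setIntegral_const,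
            setIntegral_indicator hSm, setIntegral_const, smul_eq_mul, smul_eq_mul,
            volume_real_closedBall _ (by positivity)]
  have hfirst : (2 * (2 * U * δ)) ^ n * (δ ^ γ * W ^ (-(n:ℝ) - γ)) ≤
      4 ^ n * 3 ^ (n + 1) * U ^ n * (N + inorm m) ^ (-(n:ℝ) - γ) := by
    have e1 : W ^ (-(n:ℝ) - γ) = (δ ^ γ)⁻¹ * (δ ^ n)⁻¹ * (3:ℝ) ^ ((n:ℝ) + γ) *
        (N + inorm m) ^ (-(n:ℝ) - γ) := by
      rw [hW, Real.mul_rpow (by positivity) (by positivity),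
        Real.div_rpow (by positivity) (by positivity),
        show -(n:ℝ) - γ = -((n:ℝ) + γ) by ring, Real.rpow_neg hδ.le ((n:ℝ) + γ),
        Real.rpow_neg (by norm_num : (0:ℝ) ≤ 3), Real.rpow_add hδ, Real.rpow_natCast]
      field_simp
    have e2 : (3:ℝ) ^ ((n:ℝ) + γ) ≤ 3 ^ (n + 1) := by
      rw [← Real.rpow_natCast]
      exact Real.rpow_le_rpow_of_exponent_le (by norm_num) (by push_cast; linarith)
    calc (2 * (2 * U * δ)) ^ n * (δ ^ γ * W ^ (-(n:ℝ) - γ))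
        = 4 ^ n * (3:ℝ) ^ ((n:ℝ) + γ) * U ^ n * (N + inorm m) ^ (-(n:ℝ) - γ) := by
          rw [e1, show 2 * (2 * U * δ) = 4 * U * δ by ring, mul_pow, mul_pow]
          have : 0 < δ ^ γ := by positivity
          field_simp
      _ ≤ _ := by gcongr
  have hsecond : volume.real (D ∩ S) * (R ^ n)⁻¹ ≤
      n * U ^ n * (if |inorm m - 4 * N| ≤ 3 * U then (N ^ n * U)⁻¹ else 0) := by
    split_ifs with h
    · calc volume.real (D ∩ S) * (R ^ n)⁻¹
          ≤ 4 * n * δ * (2 * (2 * U * δ)) ^ (n - 1) * (R ^ n)⁻¹ := by gcongr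
        _ = _ := by
          have e : n = n - 1 + 1 := (Nat.sub_add_cancel hn).symm
          rw [show 2 * (2 * U * δ) = 4 * U * δ by ring, hR]
          generalize (n:ℝ) = c
          rw [e, Nat.add_sub_cancel]
          simp only [mul_pow, pow_succ]
          field_simp
    · have : D ∩ S = ∅ := by
        rw [Set.eq_empty_iff_forall_notMem]
        rintro y ⟨hy, hs⟩
        apply h
        have h1 := hdist y hy
        rw [hS, Set.mem_ofPred_eq, abs_le] at hs
        have h2 : δ ≤ U * δ := le_mul_of_one_le_left hδ.le hU1
        rw [abs_le]
        constructor
        · refine le_of_mul_le_mul_left ?_ hδ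
          linarith
        · refine le_of_mul_le_mul_left ?_ hδ
          linarith
      simp [this]
  refine (hsplit.trans (add_le_add hfirst hsecond)).trans ?_
  have hc : coeffBd n γ u v m = (N + inorm m) ^ (-(n:ℝ) - γ) +
      (if |inorm m - 4 * N| ≤ 3 * U then (N ^ n * U)⁻¹ else 0) := by
    simp only [coeffBd, ← hN, ← hU]
  rw [hc]
  have h1 : 0 ≤ (N + inorm m) ^ (-(n:ℝ) - γ) := by positivity
  have h2 : 0 ≤ (if |inorm m - 4 * N| ≤ 3 * U then (N ^ n * U)⁻¹ else 0) := by
    split_ifs <;> positivity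
  generalize (N + inorm m) ^ (-(n:ℝ) - γ) = a at *
  generalize (if |inorm m - 4 * N| ≤ 3 * U then (N ^ n * U)⁻¹ else 0) = b at *
  have h3 : 0 ≤ (n:ℝ) * U ^ n * a := by positivity
  have h4 : 0 ≤ 4 ^ n * 3 ^ (n + 1) * U ^ n * b := by positivity
  linarith

/-! ### Dyadic cubes, Haar functions and conditional expectations -/

/-- The index of the dyadic cube of generation `k` containing `x`. -/
def cellIdx {n : ℕ} (k : ℤ) (x : Fin n → ℝ) : Fin n → ℤ := fun i => ⌊(2:ℝ) ^ k * x i⌋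

lemma zpow_neg_mul_le_iff (k : ℤ) (a t : ℝ) : (2:ℝ) ^ (-k) * a ≤ t ↔ a ≤ (2:ℝ) ^ k * t := by
  rw [zpow_neg, inv_mul_le_iff₀ (by positivity)]

lemma lt_zpow_neg_mul_iff (k : ℤ) (a t : ℝ) : t < (2:ℝ) ^ (-k) * a ↔ (2:ℝ) ^ k * t < a := by
  rw [zpow_neg, lt_inv_mul_iff₀ (by positivity)]

lemma mem_dyadicCube_iff {n : ℕ} {k : ℤ} {m : Fin n → ℤ} {x : Fin n → ℝ} :
    x ∈ dyadicCube n k m ↔ cellIdx k x = m := by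
  simp only [dyadicCube, Set.mem_ofPred_eq, zpow_neg_mul_le_iff, lt_zpow_neg_mul_iff, cellIdx,
    funext_iff, Int.floor_eq_iff]

lemma floor_zpow_mul_eq_of_le {i j : ℤ} (hij : i ≤ j) {s t : ℝ}
    (h : ⌊(2:ℝ) ^ j * s⌋ = ⌊(2:ℝ) ^ j * t⌋) : ⌊(2:ℝ) ^ i * s⌋ = ⌊(2:ℝ) ^ i * t⌋ := by
  obtain ⟨d, rfl⟩ := Int.le.dest hij
  have key : ∀ r : ℝ, (2:ℝ) ^ i * r = (2:ℝ) ^ (i + (d:ℤ)) * r / ((2 ^ d : ℕ) : ℝ) := by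
    intro r
    rw [zpow_add₀ (by norm_num), zpow_natCast]
    push_cast
    field_simp
  rw [key s, key t, Int.floor_div_natCast, Int.floor_div_natCast, h]

lemma cellIdx_eq_of_le {n : ℕ} {i j : ℤ} (hij : i ≤ j) {x y : Fin n → ℝ}
    (h : cellIdx j x = cellIdx j y) : cellIdx i x = cellIdx i y :=
  funext fun l => floor_zpow_mul_eq_of_le hij (congrFun h l)

lemma measurable_cellIdx {n : ℕ} (k : ℤ) : Measurable (cellIdx k : (Fin n → ℝ) → Fin n → ℤ) :=
  measurable_pi_iff.2 fun i => Int.measurable_floor.comp (by fun_prop)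

lemma dist_le_of_cellIdx_eq {n : ℕ} {k : ℤ} {x y : Fin n → ℝ} (h : cellIdx k x = cellIdx k y) :
    dist x y ≤ (2:ℝ) ^ (-k) := by
  refine (dist_pi_le_iff (by positivity)).2 fun i => ?_
  have h1 := mem_dyadicCube_iff.2 h i
  have h2 := mem_dyadicCube_iff.2 (rfl : cellIdx k y = _) i
  rw [Real.dist_eq, abs_le]
  constructor <;> nlinarith [h1.1, h1.2, h2.1, h2.2]

lemma dist_cubeCenter_le {n : ℕ} {k : ℤ} {x : Fin n → ℝ} {m : Fin n → ℤ} (h : cellIdx k x = m) :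
    dist x (cubeCenter n k m) ≤ (2:ℝ) ^ (-k) := by
  refine (dist_pi_le_iff (by positivity)).2 fun i => ?_
  have h1 := mem_dyadicCube_iff.2 h i
  have h3 : (0:ℝ) < 2 ^ (-k) := by positivity
  rw [Real.dist_eq, abs_le, cubeCenter]
  constructor <;> nlinarith [h1.1, h1.2]

lemma dist_cubeCenter_add {n : ℕ} (k : ℤ) (mI m : Fin n → ℤ) :
    dist (cubeCenter n k mI) (cubeCenter n k (mI + m)) = (2:ℝ) ^ (-k) * inorm m := by
  have : cubeCenter n k mI - cubeCenter n k (mI + m)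
      = (-(2:ℝ) ^ (-k)) • (fun i => (m i : ℝ) : Fin n → ℝ) := by
    ext i
    simp only [cubeCenter, Pi.sub_apply, Pi.smul_apply, Pi.add_apply, Int.cast_add, smul_eq_mul]
    ring
  rw [dist_eq_norm, this, norm_smul, norm_neg, Real.norm_of_nonneg (by positivity), inorm]

lemma cellIdx_cubeCenter {n : ℕ} (k : ℤ) (m : Fin n → ℤ) : cellIdx k (cubeCenter n k m) = m := by
  rw [← mem_dyadicCube_iff]
  intro i
  have h3 : (0:ℝ) < 2 ^ (-k) := by positivity
  simp only [cubeCenter]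
  constructor <;> nlinarith

lemma dyadicCube_eq_pi (n : ℕ) (k : ℤ) (m : Fin n → ℤ) : dyadicCube n k m =
    Set.univ.pi fun i => Set.Ico ((2:ℝ) ^ (-k) * m i) ((2:ℝ) ^ (-k) * (m i + 1)) := by
  ext x; simp [dyadicCube]

lemma measurableSet_dyadicCube (n : ℕ) (k : ℤ) (m : Fin n → ℤ) :
    MeasurableSet (dyadicCube n k m) := by
  rw [dyadicCube_eq_pi]
  exact MeasurableSet.univ_pi fun _ => measurableSet_Ico

lemma volume_dyadicCube (n : ℕ) (k : ℤ) (m : Fin n → ℤ) :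
    volume (dyadicCube n k m) = ENNReal.ofReal (((2:ℝ) ^ (-k)) ^ n) := by
  rw [dyadicCube_eq_pi, Real.volume_pi_Ico, ENNReal.ofReal_pow (by positivity)]
  have : ∀ i, (2:ℝ) ^ (-k) * (m i + 1) - (2:ℝ) ^ (-k) * m i = (2:ℝ) ^ (-k) := fun i => by ring
  simp only [this, Finset.prod_const, Finset.card_univ, Fintype.card_fin]

lemma volume_dyadicCube_ne_top (n : ℕ) (k : ℤ) (m : Fin n → ℤ) :
    volume (dyadicCube n k m) ≠ ⊤ := by
  rw [volume_dyadicCube]; exact ENNReal.ofReal_ne_top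

lemma volume_real_dyadicCube (n : ℕ) (k : ℤ) (m : Fin n → ℤ) :
    volume.real (dyadicCube n k m) = ((2:ℝ) ^ (-k)) ^ n := by
  rw [Measure.real, volume_dyadicCube, ENNReal.toReal_ofReal (by positivity)]

lemma zpow_mul_natCast_eq (n : ℕ) (k : ℤ) : (2:ℝ) ^ (k * (n:ℤ)) = (((2:ℝ) ^ (-k)) ^ n)⁻¹ := by
  rw [zpow_mul, zpow_natCast, zpow_neg, inv_pow, inv_inv]

lemma mem_Ico_zpow_iff (k : ℤ) (a b t : ℝ) :
    t ∈ Set.Ico ((2:ℝ) ^ (-k) * a) ((2:ℝ) ^ (-k) * b) ↔ a ≤ (2:ℝ) ^ k * t ∧ (2:ℝ) ^ k * t < b := by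
  rw [Set.mem_Ico, zpow_neg_mul_le_iff, lt_zpow_neg_mul_iff]

lemma haar1D_false (k m : ℤ) (t : ℝ) : haar1D k m false t =
    (Real.sqrt ((2:ℝ) ^ (-k)))⁻¹ * if ⌊(2:ℝ) ^ k * t⌋ = m then 1 else 0 := by
  simp only [haar1D, Bool.false_eq_true, if_false, Set.indicator_apply, mem_Ico_zpow_iff,
    Int.floor_eq_iff, Pi.one_apply]

lemma haar1D_true (k m : ℤ) (t : ℝ) : haar1D k m true t =
    (Real.sqrt ((2:ℝ) ^ (-k)))⁻¹ * ((if ⌊(2:ℝ) ^ (k + 1) * t⌋ = 2 * m then 1 else 0) -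
      if ⌊(2:ℝ) ^ (k + 1) * t⌋ = 2 * m + 1 then 1 else 0) := by
  have e : (2:ℝ) ^ (k + 1) * t = 2 * ((2:ℝ) ^ k * t) := by
    rw [zpow_add_one₀ (by norm_num)]; ring
  simp only [haar1D, if_true, Set.indicator_apply, mem_Ico_zpow_iff, Int.floor_eq_iff,
    Pi.one_apply, e]
  push_cast
  generalize (2:ℝ) ^ k * t = r
  have e1 : ((m:ℝ) ≤ r ∧ r < m + 1 / 2) ↔ (2 * (m:ℝ) ≤ 2 * r ∧ 2 * r < 2 * m + 1) := by
    constructor <;> rintro ⟨h1, h2⟩ <;> constructor <;> linarith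
  have e2 : ((m:ℝ) + 1 / 2 ≤ r ∧ r < m + 1) ↔
      (2 * (m:ℝ) + 1 ≤ 2 * r ∧ 2 * r < 2 * m + 1 + 1) := by
    constructor <;> rintro ⟨h1, h2⟩ <;> constructor <;> linarith
  simp only [e1, e2]

lemma floor_eq_of_floor_succ {k m : ℤ} {t : ℝ}
    (h : ⌊(2:ℝ) ^ (k + 1) * t⌋ = 2 * m ∨ ⌊(2:ℝ) ^ (k + 1) * t⌋ = 2 * m + 1) :
    ⌊(2:ℝ) ^ k * t⌋ = m := by
  have e : (2:ℝ) ^ k * t = (2:ℝ) ^ (k + 1) * t / ((2:ℕ) : ℝ) := by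
    rw [zpow_add_one₀ (by norm_num)]; push_cast; ring
  rw [e, Int.floor_div_natCast]
  push_cast
  omega

lemma haar1D_ne_zero {k m : ℤ} {η : Bool} {t : ℝ} (h : haar1D k m η t ≠ 0) :
    ⌊(2:ℝ) ^ k * t⌋ = m := by
  cases η
  · rw [haar1D_false] at h
    by_contra hc
    simp [hc] at h
  · rw [haar1D_true] at h
    by_contra hc
    apply h
    have h' := fun hh => hc (floor_eq_of_floor_succ (k := k) (m := m) (t := t) hh)
    rw [if_neg fun hh => h' (Or.inl hh), if_neg fun hh => h' (Or.inr hh)]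
    simp

lemma abs_haar1D_le (k m : ℤ) (η : Bool) (t : ℝ) :
    |haar1D k m η t| ≤ (Real.sqrt ((2:ℝ) ^ (-k)))⁻¹ := by
  have h0 : 0 ≤ (Real.sqrt ((2:ℝ) ^ (-k)))⁻¹ := by positivity
  cases η
  · rw [haar1D_false, abs_mul, abs_of_nonneg h0]
    refine mul_le_of_le_one_right h0 ?_
    split_ifs <;> simp
  · rw [haar1D_true, abs_mul, abs_of_nonneg h0]
    refine mul_le_of_le_one_right h0 ?_
    split_ifs <;> first | omega | simp

lemma measurable_haar1D (k m : ℤ) (η : Bool) : Measurable (haar1D k m η) := by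
  unfold haar1D
  cases η
  · simp only [Bool.false_eq_true, if_false]
    exact (measurable_one.indicator measurableSet_Ico).const_mul _
  · simp only [if_true]
    exact ((measurable_one.indicator measurableSet_Ico).sub
      (measurable_one.indicator measurableSet_Ico)).const_mul _

lemma integral_haar1D_true (k m : ℤ) : ∫ t, haar1D k m true t = 0 := by
  have hp : (0:ℝ) < 2 ^ (-k) := by positivity
  have hi : ∀ a b : ℝ, Integrable ((Set.Ico a b).indicator (1 : ℝ → ℝ)) := fun a b =>
    (integrable_indicator_iff measurableSet_Ico).2 (integrableOn_const measure_Ico_lt_top.ne)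
  have hv : ∀ a b : ℝ, a ≤ b → ∫ t, (Set.Ico a b).indicator (1 : ℝ → ℝ) t = b - a :=
    fun a b hab => by
      rw [integral_indicator_one measurableSet_Ico, Real.volume_real_Ico_of_le hab]
  simp only [haar1D, if_true]
  rw [integral_const_mul, integral_sub (hi _ _) (hi _ _), hv _ _ (by nlinarith),
    hv _ _ (by nlinarith)]
  ring

/-- The sup norm of a Haar function of generation `k`. -/
def haarAmp (n : ℕ) (k : ℤ) : ℝ := ((Real.sqrt ((2:ℝ) ^ (-k)))⁻¹) ^ n

lemma haarAmp_pos (n : ℕ) (k : ℤ) : 0 < haarAmp n k := by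
  unfold haarAmp; positivity

lemma haarAmp_mul_haarAmp (n : ℕ) (k : ℤ) :
    haarAmp n k * haarAmp n k * ((2:ℝ) ^ (-k)) ^ n = 1 := by
  have hp : (0:ℝ) < 2 ^ (-k) := by positivity
  rw [haarAmp, ← mul_pow, ← mul_inv, Real.mul_self_sqrt hp.le, ← mul_pow,
    inv_mul_cancel₀ hp.ne', one_pow]

section Haar

variable {n : ℕ} {k : ℤ} {m : Fin n → ℤ} {η : Fin n → Bool}

lemma haarFn_ne_zero {x : Fin n → ℝ} (h : haarFn n k m η x ≠ 0) : cellIdx k x = m :=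
  funext fun i => haar1D_ne_zero (Finset.prod_ne_zero_iff.1 h i (Finset.mem_univ i))

lemma haarFn_congr {x y : Fin n → ℝ} (h : cellIdx (k + 1) x = cellIdx (k + 1) y) :
    haarFn n k m η x = haarFn n k m η y := by
  refine Finset.prod_congr rfl fun i _ => ?_
  have h1 : ⌊(2:ℝ) ^ (k + 1) * x i⌋ = ⌊(2:ℝ) ^ (k + 1) * y i⌋ := congrFun h i
  cases η i
  · rw [haar1D_false, haar1D_false, floor_zpow_mul_eq_of_le (by omega) h1]
  · rw [haar1D_true, haar1D_true, h1]

lemma haarFn_false_congr {x y : Fin n → ℝ} (h : cellIdx k x = cellIdx k y) :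
    haarFn n k m (fun _ => false) x = haarFn n k m (fun _ => false) y := by
  refine Finset.prod_congr rfl fun i _ => ?_
  have h1 : ⌊(2:ℝ) ^ k * x i⌋ = ⌊(2:ℝ) ^ k * y i⌋ := congrFun h i
  rw [haar1D_false, haar1D_false, h1]

lemma abs_haarFn_le (x : Fin n → ℝ) : |haarFn n k m η x| ≤ haarAmp n k := by
  rw [haarFn, Finset.abs_prod, haarAmp]
  refine (Finset.prod_le_prod (fun _ _ => abs_nonneg _) fun i _ => abs_haar1D_le _ _ _ _).trans ?_
  simp

lemma abs_haarFn_le_indicator (x : Fin n → ℝ) :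
    |haarFn n k m η x| ≤ (dyadicCube n k m).indicator (fun _ => haarAmp n k) x := by
  by_cases h : haarFn n k m η x = 0
  · rw [h, abs_zero]
    exact Set.indicator_nonneg (fun _ _ => (haarAmp_pos n k).le) x
  · rw [Set.indicator_of_mem (mem_dyadicCube_iff.2 (haarFn_ne_zero h))]
    exact abs_haarFn_le x

lemma measurable_haarFn : Measurable (haarFn n k m η) :=
  Finset.measurable_fun_prod _ fun i _ => (measurable_haar1D _ _ _).comp (measurable_pi_apply i)

lemma integrable_indicator_dyadicCube (c : ℝ) :
    Integrable ((dyadicCube n k m).indicator fun _ => c) :=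
  (integrable_indicator_iff (measurableSet_dyadicCube n k m)).2
    (integrableOn_const (volume_dyadicCube_ne_top n k m))

lemma integrable_haarFn : Integrable (haarFn n k m η) :=
  (integrable_indicator_dyadicCube _).mono' measurable_haarFn.aestronglyMeasurable
    (Filter.Eventually.of_forall abs_haarFn_le_indicator)

lemma integral_abs_haarFn_le :
    ∫ x, |haarFn n k m η x| ≤ haarAmp n k * ((2:ℝ) ^ (-k)) ^ n := by
  refine (integral_mono integrable_haarFn.abs (integrable_indicator_dyadicCube _)
    abs_haarFn_le_indicator).trans ?_
  rw [integral_indicator (measurableSet_dyadicCube n k m), setIntegral_const,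
    volume_real_dyadicCube, smul_eq_mul, mul_comm]

lemma integral_haarFn_eq_zero (h : η ≠ fun _ => false) : ∫ x, haarFn n k m η x = 0 := by
  obtain ⟨i, hi⟩ := Function.ne_iff.1 h
  have := integral_fintype_prod_eq_prod (μ := fun _ : Fin n => (volume : Measure ℝ))
    (fun i t => haar1D k (m i) (η i) t)
  rw [← volume_pi] at this
  simp only [haarFn]
  rw [this]
  refine Finset.prod_eq_zero (Finset.mem_univ i) ?_
  have hi' : η i = true := by simpa using hi
  rw [hi']
  exact integral_haar1D_true k (m i)

end Haar

section Expectation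

variable {n : ℕ} {k : ℤ}

lemma dyadicE_congr (f : (Fin n → ℝ) → ℝ) {x y : Fin n → ℝ} (h : cellIdx k x = cellIdx k y) :
    dyadicE n k f x = dyadicE n k f y := by
  change _ * ∫ z in dyadicCube n k (cellIdx k x), f z = _ * ∫ z in dyadicCube n k (cellIdx k y), f z
  rw [h]

lemma measurable_dyadicE (f : (Fin n → ℝ) → ℝ) : Measurable (dyadicE n k f) := by
  have : Measurable fun m : Fin n → ℤ => (2:ℝ) ^ (k * (n:ℤ)) * ∫ y in dyadicCube n k m, f y :=
    Measurable.of_discrete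
  exact this.comp (measurable_cellIdx k)

lemma dyadicE_eq_self {f : (Fin n → ℝ) → ℝ} {x : Fin n → ℝ}
    (h : ∀ y, cellIdx k y = cellIdx k x → f y = f x) : dyadicE n k f x = f x := by
  change _ * ∫ z in dyadicCube n k (cellIdx k x), f z = _
  rw [setIntegral_congr_fun (measurableSet_dyadicCube _ _ _)
    (fun y hy => h y (mem_dyadicCube_iff.1 hy)), setIntegral_const, volume_real_dyadicCube,
    zpow_mul_natCast_eq, smul_eq_mul, inv_mul_cancel_left₀ (by positivity)]

lemma dyadicE_eq_zero {f : (Fin n → ℝ) → ℝ} {x : Fin n → ℝ}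
    (h : ∀ y, cellIdx k y = cellIdx k x → f y = 0) : dyadicE n k f x = 0 := by
  change _ * ∫ z in dyadicCube n k (cellIdx k x), f z = _
  rw [setIntegral_eq_zero_of_forall_eq_zero (fun y hy => h y (mem_dyadicCube_iff.1 hy)), mul_zero]

lemma abs_dyadicE_le {f : (Fin n → ℝ) → ℝ} (hf : Integrable f) (x : Fin n → ℝ) :
    |dyadicE n k f x| ≤ (((2:ℝ) ^ (-k)) ^ n)⁻¹ * ∫ y, |f y| := by
  rw [dyadicE, abs_mul, abs_of_nonneg (by positivity), zpow_mul_natCast_eq]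
  refine mul_le_mul_of_nonneg_left ?_ (by positivity)
  exact (abs_integral_le_integral_abs).trans
    (setIntegral_le_integral hf.abs (Filter.Eventually.of_forall fun _ => abs_nonneg _))

lemma dyadicE_haarFn_eq_zero {k₀ : ℤ} (hk : k ≤ k₀) {m : Fin n → ℤ} {η : Fin n → Bool}
    (hη : η ≠ fun _ => false) (x : Fin n → ℝ) : dyadicE n k (haarFn n k₀ m η) x = 0 := by
  by_cases h : ∃ p, cellIdx k p = cellIdx k x ∧ haarFn n k₀ m η p ≠ 0
  · obtain ⟨p, hp, hp0⟩ := h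
    change _ * ∫ z in dyadicCube n k (cellIdx k x), haarFn n k₀ m η z = _
    rw [setIntegral_eq_integral_of_forall_compl_eq_zero, integral_haarFn_eq_zero hη, mul_zero]
    intro y hy
    by_contra hy0
    apply hy
    rw [mem_dyadicCube_iff, ← hp]
    exact cellIdx_eq_of_le hk ((haarFn_ne_zero hy0).trans (haarFn_ne_zero hp0).symm)
  · push Not at h
    exact dyadicE_eq_zero h

lemma dyadicE_haarFn_eq_self {k₀ : ℤ} (hk : k₀ + 1 ≤ k) {m : Fin n → ℤ} {η : Fin n → Bool}
    (x : Fin n → ℝ) : dyadicE n k (haarFn n k₀ m η) x = haarFn n k₀ m η x :=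
  dyadicE_eq_self fun _ hy => haarFn_congr (cellIdx_eq_of_le hk hy)

lemma dyadicE_haarFn_false_eq_self {k₀ : ℤ} (hk : k₀ ≤ k) {m : Fin n → ℤ} (x : Fin n → ℝ) :
    dyadicE n k (haarFn n k₀ m fun _ => false) x = haarFn n k₀ m (fun _ => false) x :=
  dyadicE_eq_self fun _ hy => haarFn_false_congr (cellIdx_eq_of_le hk hy)

lemma dyadicD_haarFn_self {k₀ : ℤ} {m : Fin n → ℤ} {η : Fin n → Bool}
    (hη : η ≠ fun _ => false) : dyadicD n k₀ (haarFn n k₀ m η) = haarFn n k₀ m η := by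
  ext x
  rw [dyadicD, dyadicE_haarFn_eq_self le_rfl, dyadicE_haarFn_eq_zero le_rfl hη, sub_zero]

lemma dyadicD_haarFn_of_ne {k₀ : ℤ} (hk : k ≠ k₀) {m : Fin n → ℤ} {η : Fin n → Bool}
    (hη : η ≠ fun _ => false) : dyadicD n k (haarFn n k₀ m η) = 0 := by
  ext x
  rcases lt_or_gt_of_ne hk with h | h
  · rw [dyadicD, dyadicE_haarFn_eq_zero (by omega) hη, dyadicE_haarFn_eq_zero h.le hη, sub_zero,
      Pi.zero_apply]
  · rw [dyadicD, dyadicE_haarFn_eq_self (by omega), dyadicE_haarFn_eq_self (by omega), sub_self,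
      Pi.zero_apply]

lemma dyadicD_haarFn_false_of_le {k₀ : ℤ} (hk : k₀ ≤ k) {m : Fin n → ℤ} :
    dyadicD n k (haarFn n k₀ m fun _ => false) = 0 := by
  ext x
  rw [dyadicD, dyadicE_haarFn_false_eq_self (by omega), dyadicE_haarFn_false_eq_self hk, sub_self,
    Pi.zero_apply]

lemma dist_le_of_dyadicE_haarFn_ne_zero {k₀ : ℤ} (hk : k ≤ k₀) {m : Fin n → ℤ} {η : Fin n → Bool}
    {x : Fin n → ℝ} (h : dyadicE n k (haarFn n k₀ m η) x ≠ 0) :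
    dist x (cubeCenter n k₀ m) ≤ (2:ℝ) ^ (-k) := by
  by_contra hc
  refine h (dyadicE_eq_zero fun y hy => ?_)
  by_contra hy0
  refine hc (dist_le_of_cellIdx_eq (hy.symm.trans (cellIdx_eq_of_le hk ?_)))
  rw [haarFn_ne_zero hy0, cellIdx_cubeCenter]

lemma dist_le_of_dyadicD_haarFn_ne_zero {k₀ : ℤ} (hk : k < k₀) {m : Fin n → ℤ}
    {η : Fin n → Bool} {x : Fin n → ℝ} (h : dyadicD n k (haarFn n k₀ m η) x ≠ 0) :
    dist x (cubeCenter n k₀ m) ≤ (2:ℝ) ^ (-k) := by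
  by_cases h1 : dyadicE n k (haarFn n k₀ m η) x = 0
  · rw [dyadicD, h1, sub_zero] at h
    exact (dist_le_of_dyadicE_haarFn_ne_zero (by omega) h).trans
      (zpow_le_zpow_right₀ (by norm_num) (by omega))
  · exact dist_le_of_dyadicE_haarFn_ne_zero hk.le h1

lemma abs_dyadicD_haarFn_le {k₀ : ℤ} {m : Fin n → ℤ} {η : Fin n → Bool} (x : Fin n → ℝ) :
    |dyadicD n k (haarFn n k₀ m η) x| ≤
      2 * 2 ^ n * (((2:ℝ) ^ (-k)) ^ n)⁻¹ * (haarAmp n k₀ * ((2:ℝ) ^ (-k₀)) ^ n) := by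
  have hI := integral_abs_haarFn_le (n := n) (k := k₀) (m := m) (η := η)
  have h0 : 0 ≤ haarAmp n k₀ * ((2:ℝ) ^ (-k₀)) ^ n :=
    (integral_nonneg fun _ => abs_nonneg _).trans hI
  have h1 := (abs_dyadicE_le (k := k + 1) (integrable_haarFn (n := n) (k := k₀) (m := m) (η := η))
    x).trans (mul_le_mul_of_nonneg_left hI (by positivity))
  have h2 := (abs_dyadicE_le (k := k) (integrable_haarFn (n := n) (k := k₀) (m := m) (η := η))
    x).trans (mul_le_mul_of_nonneg_left hI (by positivity))
  have e : (((2:ℝ) ^ (-(k + 1))) ^ n)⁻¹ = 2 ^ n * (((2:ℝ) ^ (-k)) ^ n)⁻¹ := by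
    rw [neg_add, zpow_add₀ (by norm_num), mul_pow, mul_inv, mul_comm]
    simp
  rw [e] at h1
  have h3 : (((2:ℝ) ^ (-k)) ^ n)⁻¹ ≤ 2 ^ n * (((2:ℝ) ^ (-k)) ^ n)⁻¹ :=
    le_mul_of_one_le_left (by positivity) (one_le_pow₀ (by norm_num))
  have h4 := mul_le_mul_of_nonneg_right h3 h0
  refine (abs_sub _ _).trans ?_
  linarith

end Expectation

/-! ### Haar coefficients of `Ψ_s` -/

lemma czTrunc_zero {n : ℕ} (K : (Fin n → ℝ) → (Fin n → ℝ) → ℝ) (R : ℝ) : czTrunc K R 0 = 0 := by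
  ext x; simp [czTrunc]

lemma dyadicE_zero (n : ℕ) (k : ℤ) : dyadicE n k 0 = 0 := by
  ext x; simp [dyadicE]

lemma zpow_neg_sub_natCast (k : ℤ) (t : ℕ) : (2:ℝ) ^ (-(k - (t:ℤ))) = 2 ^ t * 2 ^ (-k) := by
  rw [neg_sub, sub_eq_add_neg, zpow_add₀ (by norm_num), zpow_natCast]

/-- The constant of `setIntegral_oscBd_le`. -/
def oscConst (n : ℕ) : ℝ := 4 ^ n * 3 ^ (n + 1) + n

lemma oscConst_pos (n : ℕ) : 0 < oscConst n := by
  unfold oscConst; positivity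

lemma abs_integral_mul_le_of_integral_eq_zero {α : Type*} [MeasurableSpace α] {μ : Measure α}
    {h F : α → ℝ} (hh : Integrable h μ) (h0 : ∫ x, h x ∂μ = 0) {c M : ℝ} (hM : 0 ≤ M)
    (hF : ∀ x, h x ≠ 0 → |F x - c| ≤ M) : |∫ x, h x * F x ∂μ| ≤ M * ∫ x, |h x| ∂μ := by
  by_cases hi : Integrable (fun x => h x * F x) μ
  · have e : ∫ x, h x * F x ∂μ = ∫ x, h x * (F x - c) ∂μ := by
      simp only [mul_sub]
      rw [integral_sub hi (hh.mul_const c), integral_mul_const, h0, zero_mul, sub_zero]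
    rw [e, ← integral_const_mul, ← Real.norm_eq_abs]
    refine norm_integral_le_of_norm_le (hh.abs.const_mul M) (Filter.Eventually.of_forall
      fun x => ?_)
    rw [Real.norm_eq_abs, abs_mul, mul_comm]
    by_cases hx : h x = 0
    · simp [hx]
    · exact mul_le_mul_of_nonneg_right (hF x hx) (abs_nonneg _)
  · rw [integral_undef hi, abs_zero]
    exact mul_nonneg hM (integral_nonneg fun _ => abs_nonneg _)

lemma abs_tsum_sub_tsum_le {ι : Type*} {a b g : ι → ℝ} (hg : Summable g)
    (h : ∀ i, |a i - b i| ≤ g i) : |∑' i, a i - ∑' i, b i| ≤ ∑' i, g i := by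
  have hd : Summable fun i => a i - b i := Summable.of_norm_bounded hg h
  by_cases hb : Summable b
  · have ha : Summable a := by simpa using hd.add hb
    rw [← ha.tsum_sub hb]
    rw [← Real.norm_eq_abs]
    exact tsum_of_norm_bounded (f := fun i => a i - b i) hg.hasSum h
  · have ha : ¬ Summable a := fun ha => hb (by simpa using ha.sub hd)
    rw [tsum_eq_zero_of_not_summable hb, tsum_eq_zero_of_not_summable ha, sub_zero, abs_zero]
    exact tsum_nonneg fun i => (abs_nonneg _).trans (h i)

section Coefficients

variable {n : ℕ} {γ : ℝ} {K : (Fin n → ℝ) → (Fin n → ℝ) → ℝ}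

lemma PsiOp_haarFn {ζ : Fin n → Bool} (hζ : ζ ≠ fun _ => false) (s : ℕ) (k : ℤ)
    (mI : Fin n → ℤ) (x : Fin n → ℝ) : PsiOp n K s (haarFn n k mI ζ) x =
      czTrunc K (4 * (2 ^ s * 2 ^ (-k))) (haarFn n k mI ζ) x -
      dyadicE n (k - s) (czTrunc K (4 * (2 ^ s * 2 ^ (-k))) (haarFn n k mI ζ)) x := by
  unfold PsiOp
  rw [tsum_eq_single (k - (s:ℤ))]
  · rw [sub_add_cancel, dyadicD_haarFn_self hζ, zpow_neg_sub_natCast]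
  · intro j hj
    rw [dyadicD_haarFn_of_ne (by omega) hζ, czTrunc_zero, dyadicE_zero]
    simp

lemma abs_dyadicE_czTrunc_haarFn_le (hn : 0 < n) (hγ0 : 0 < γ) (hγ1 : γ ≤ 1)
    (hK : IsNormalisedKernel n γ K) {ζ : Fin n → Bool} (hζ : ζ ≠ fun _ => false) (s : ℕ) (k : ℤ)
    (mI m : Fin n → ℤ) {x : Fin n → ℝ} (hx : cellIdx k x = mI + m) :
    |dyadicE n (k - s) (czTrunc K (4 * (2 ^ s * 2 ^ (-k))) (haarFn n k mI ζ)) x| ≤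
      haarAmp n k * oscConst n * coeffBd n γ s s m := by
  set δ : ℝ := (2:ℝ) ^ (-k) with hδ
  have hδ0 : 0 < δ := by positivity
  have hs1 : (1:ℝ) ≤ 2 ^ s := one_le_pow₀ (by norm_num)
  have hsδ : δ ≤ 2 ^ s * δ := le_mul_of_one_le_left hδ0.le hs1
  set R : ℝ := 4 * (2 ^ s * δ) with hR
  have hR0 : 0 < R := by positivity
  set c := cubeCenter n k mI
  set q := cubeCenter n k (mI + m)
  have hA := haarAmp_pos n k
  have hT : ∀ y, |czTrunc K R (haarFn n k mI ζ) y| ≤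
      oscBd n γ δ R (dist c y) * (haarAmp n k * δ ^ n) := fun y =>
    (abs_czTrunc_le_of_integral_eq_zero hK hγ0 hδ0 (by linarith) integrable_haarFn
      (integral_haarFn_eq_zero hζ) (fun y hy => dist_cubeCenter_le (haarFn_ne_zero hy)) y).trans
      (mul_le_mul_of_nonneg_left integral_abs_haarFn_le (oscBd_nonneg n γ hδ0 hR0))
  have hball : volume (Metric.closedBall q (2 * 2 ^ s * δ)) ≠ ⊤ :=
    (isCompact_closedBall _ _).measure_lt_top.ne
  have hsub : dyadicCube n (k - s) (cellIdx (k - s) x) ⊆ Metric.closedBall q (2 * 2 ^ s * δ) := by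
    intro y hy
    have h1 := dist_le_of_cellIdx_eq (mem_dyadicCube_iff.1 hy)
    rw [zpow_neg_sub_natCast] at h1
    have h2 := dist_cubeCenter_le hx
    have h3 := dist_triangle y x q
    rw [Metric.mem_closedBall]
    linarith
  have hint := integrableOn_oscBd hγ0 hδ0 hR0 c hball
  have hosc := setIntegral_oscBd_le hn hγ0 hγ1 hδ0 (le_refl s) (dist_cubeCenter_add k mI m)
  rw [dyadicE, abs_mul, abs_of_nonneg (by positivity), zpow_mul_natCast_eq,
    zpow_neg_sub_natCast, ← hδ]
  have h1 : |∫ y in dyadicCube n (k - s) (cellIdx (k - s) x),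
      czTrunc K R (haarFn n k mI ζ) y| ≤
      (oscConst n * ((2:ℝ) ^ s) ^ n * coeffBd n γ s s m) * (haarAmp n k * δ ^ n) := by
    rw [← Real.norm_eq_abs]
    refine (norm_integral_le_of_norm_le ((hint.mono_set hsub).mul_const _)
      (Filter.Eventually.of_forall hT)).trans ?_
    rw [integral_mul_const]
    refine mul_le_mul_of_nonneg_right (le_trans ?_ hosc) (by positivity)
    exact setIntegral_mono_set hint
      (Filter.Eventually.of_forall fun y => oscBd_nonneg n γ hδ0 hR0) hsub.eventuallyLE
  refine (mul_le_mul_of_nonneg_left h1 (by positivity)).trans (le_of_eq ?_)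
  rw [mul_pow]
  field_simp

/-- Haar coefficients of `Ψ_s` on a cancellative Haar function. -/
lemma abs_pairing_PsiOp_haarFn_le (hn : 0 < n) (hγ0 : 0 < γ) (hγ1 : γ ≤ 1)
    (hK : IsNormalisedKernel n γ K) (θ : Fin n → Bool) {ζ : Fin n → Bool}
    (hζ : ζ ≠ fun _ => false) (s : ℕ) (k : ℤ) (mI m : Fin n → ℤ) :
    |pairing (haarFn n k (mI + m) θ) (PsiOp n K s (haarFn n k mI ζ))| ≤
      oscConst n * (coeffBd n γ 0 s m + coeffBd n γ s s m) := by
  set δ : ℝ := (2:ℝ) ^ (-k) with hδ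
  have hδ0 : 0 < δ := by positivity
  have hs1 : (1:ℝ) ≤ 2 ^ s := one_le_pow₀ (by norm_num)
  have hsδ : δ ≤ 2 ^ s * δ := le_mul_of_one_le_left hδ0.le hs1
  set R : ℝ := 4 * (2 ^ s * δ) with hR
  have hR0 : 0 < R := by positivity
  set c := cubeCenter n k mI
  set q := cubeCenter n k (mI + m)
  set J := dyadicCube n k (mI + m)
  set A := haarAmp n k
  set e : ℝ := oscConst n * coeffBd n γ s s m
  have hA : 0 < A := haarAmp_pos n k
  have hAA : A * A * δ ^ n = 1 := haarAmp_mul_haarAmp n k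
  have hJfin : volume J ≠ ⊤ := volume_dyadicCube_ne_top _ _ _
  have hball : volume (Metric.closedBall q (2 * 2 ^ 0 * δ)) ≠ ⊤ :=
    (isCompact_closedBall _ _).measure_lt_top.ne
  have hsub : J ⊆ Metric.closedBall q (2 * 2 ^ 0 * δ) := by
    intro y hy
    have h1 := dist_cubeCenter_le (mem_dyadicCube_iff.1 hy)
    rw [Metric.mem_closedBall]
    linarith
  have hint := integrableOn_oscBd hγ0 hδ0 hR0 c hball
  have hconst : Integrable (fun _ => A * A * e) (volume.restrict J) := integrableOn_const hJfin
  have hosc := setIntegral_oscBd_le hn hγ0 hγ1 hδ0 (Nat.zero_le s) (dist_cubeCenter_add k mI m)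
  have hpt : ∀ x, ‖haarFn n k (mI + m) θ x * PsiOp n K s (haarFn n k mI ζ) x‖ ≤
      J.indicator (fun x => oscBd n γ δ R (dist c x) + A * A * e) x := by
    intro x
    by_cases hx0 : haarFn n k (mI + m) θ x = 0
    · rw [hx0, zero_mul, norm_zero]
      refine Set.indicator_nonneg (fun y _ => add_nonneg (oscBd_nonneg n γ hδ0 hR0) ?_) x
      have := oscConst_pos n
      have := coeffBd_nonneg n γ s s m
      positivity
    · have hx := haarFn_ne_zero hx0
      rw [Set.indicator_of_mem (mem_dyadicCube_iff.2 hx), Real.norm_eq_abs, abs_mul,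
        PsiOp_haarFn hζ]
      have h1 := (abs_czTrunc_le_of_integral_eq_zero hK hγ0 hδ0 (R := R) (by linarith)
        integrable_haarFn (integral_haarFn_eq_zero hζ)
        (fun y hy => dist_cubeCenter_le (haarFn_ne_zero hy)) x).trans
        (mul_le_mul_of_nonneg_left (integral_abs_haarFn_le (m := mI) (η := ζ))
          (oscBd_nonneg n γ hδ0 hR0))
      have h2 := abs_dyadicE_czTrunc_haarFn_le hn hγ0 hγ1 hK hζ s k mI m hx
      have h3 := (abs_sub (czTrunc K R (haarFn n k mI ζ) x)
        (dyadicE n (k - s) (czTrunc K R (haarFn n k mI ζ)) x)).trans (add_le_add h1 h2)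
      refine (mul_le_mul (abs_haarFn_le x) h3 (abs_nonneg _) hA.le).trans (le_of_eq ?_)
      calc A * (oscBd n γ δ R (dist c x) * (A * δ ^ n) + A * oscConst n * coeffBd n γ s s m)
          = (A * A * δ ^ n) * oscBd n γ δ R (dist c x) + A * A * e := by ring
        _ = _ := by rw [hAA, one_mul]
  unfold pairing
  rw [← Real.norm_eq_abs]
  refine (norm_integral_le_of_norm_le ((integrable_indicator_iff
    (measurableSet_dyadicCube _ _ _)).2 ((hint.mono_set hsub).add hconst))
    (Filter.Eventually.of_forall hpt)).trans ?_
  rw [integral_indicator (measurableSet_dyadicCube _ _ _), integral_add' (hint.mono_set hsub) hconst,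
    setIntegral_const, volume_real_dyadicCube, smul_eq_mul, ← hδ]
  have h1 : ∫ y in J, oscBd n γ δ R (dist c y) ≤ oscConst n * coeffBd n γ 0 s m := by
    refine (setIntegral_mono_set hint (Filter.Eventually.of_forall fun y =>
      oscBd_nonneg n γ hδ0 hR0) hsub.eventuallyLE).trans (hosc.trans (le_of_eq ?_))
    rw [pow_zero, one_pow, mul_one, oscConst]
  calc (∫ y in J, oscBd n γ δ R (dist c y)) + δ ^ n * (A * A * e)
      = (∫ y in J, oscBd n γ δ R (dist c y)) + (A * A * δ ^ n) * e := by ring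
    _ ≤ oscConst n * coeffBd n γ 0 s m + e := by rw [hAA, one_mul]; linarith
    _ = _ := by ring

lemma abs_czTrunc_dyadicD_sub_le (hn : 0 < n) (hγ0 : 0 < γ) (hγ1 : γ ≤ 1)
    (hK : IsNormalisedKernel n γ K) (ζ : Fin n → Bool) (s t : ℕ) (k : ℤ)
    (mI m : Fin n → ℤ) {x : Fin n → ℝ} (hx : cellIdx k x = mI + m) (ht : 0 < t) :
    |czTrunc K (4 * (2 ^ (s + t) * 2 ^ (-k))) (dyadicD n (k - t) (haarFn n k mI ζ)) x -
      czTrunc K (4 * (2 ^ (s + t) * 2 ^ (-k))) (dyadicD n (k - t) (haarFn n k mI ζ))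
        (cubeCenter n k (mI + m))| ≤
      2 * 2 ^ n * oscConst n * haarAmp n k * coeffBd n γ t (s + t) m := by
  set δ : ℝ := (2:ℝ) ^ (-k) with hδ
  have hδ0 : 0 < δ := by positivity
  have hs1 : (1:ℝ) ≤ 2 ^ (s + t) := one_le_pow₀ (by norm_num)
  have hsδ : δ ≤ 2 ^ (s + t) * δ := le_mul_of_one_le_left hδ0.le hs1
  set R : ℝ := 4 * (2 ^ (s + t) * δ) with hR
  have hR0 : 0 < R := by positivity
  set c := cubeCenter n k mI
  set q := cubeCenter n k (mI + m)
  set φ := dyadicD n (k - t) (haarFn n k mI ζ) with hφ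
  set D := Metric.closedBall c (2 * 2 ^ t * δ)
  set M : ℝ := 2 * 2 ^ n * ((2 ^ t * δ) ^ n)⁻¹ * (haarAmp n k * δ ^ n) with hM
  have hA : 0 < haarAmp n k := haarAmp_pos n k
  have hM0 : 0 ≤ M := by positivity
  have hDm : MeasurableSet D := Metric.isClosed_closedBall.measurableSet
  have hball : volume D ≠ ⊤ := (isCompact_closedBall _ _).measure_lt_top.ne
  have hφD : ∀ y, |φ y| ≤ D.indicator (fun _ => M) y := by
    intro y
    by_cases hy : φ y = 0
    · rw [hy, abs_zero]
      exact Set.indicator_nonneg (fun _ _ => hM0) y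
    · have h1 := dist_le_of_dyadicD_haarFn_ne_zero (by omega) hy
      rw [zpow_neg_sub_natCast, ← hδ] at h1
      have h2 : y ∈ D := by
        rw [Metric.mem_closedBall]
        have : 0 ≤ 2 ^ t * δ := by positivity
        linarith
      rw [Set.indicator_of_mem h2]
      refine (abs_dyadicD_haarFn_le y).trans (le_of_eq ?_)
      rw [hM, zpow_neg_sub_natCast]
  have hφm : Measurable φ := (measurable_dyadicE _).sub (measurable_dyadicE _)
  have hφi : Integrable φ :=
    ((integrable_indicator_iff hDm).2 (integrableOn_const hball)).mono' hφm.aestronglyMeasurable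
      (Filter.Eventually.of_forall hφD)
  have hint := integrableOn_oscBd hγ0 hδ0 hR0 q hball
  have hosc := setIntegral_oscBd_le hn hγ0 hγ1 hδ0 (Nat.le_add_left t s)
    ((dist_comm _ _).trans (dist_cubeCenter_add k mI m))
  refine (abs_czTrunc_sub_le hK hγ0 hδ0 (R := R) (by linarith) (dist_cubeCenter_le hx) hφi).trans ?_
  calc ∫ y, oscBd n γ δ R (dist q y) * |φ y|
      ≤ ∫ y, D.indicator (fun y => oscBd n γ δ R (dist q y) * M) y := by
        refine integral_mono_of_nonneg (Filter.Eventually.of_forall fun y =>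
          mul_nonneg (oscBd_nonneg n γ hδ0 hR0) (abs_nonneg _))
          ((integrable_indicator_iff hDm).2 (hint.mul_const M))
          (Filter.Eventually.of_forall fun y => ?_)
        refine (mul_le_mul_of_nonneg_left (hφD y) (oscBd_nonneg n γ hδ0 hR0)).trans (le_of_eq ?_)
        by_cases hy : y ∈ D <;> simp [hy]
    _ = (∫ y in D, oscBd n γ δ R (dist q y)) * M := by
        rw [integral_indicator hDm, integral_mul_const]
    _ ≤ (oscConst n * ((2:ℝ) ^ t) ^ n * coeffBd n γ t (s + t) m) * M :=
        mul_le_mul_of_nonneg_right hosc hM0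
    _ = _ := by
        rw [hM, mul_pow]
        field_simp

/-- Haar coefficients of `Ψ_s` on a non-cancellative Haar function. -/
lemma abs_pairing_PsiOp_haarFn_false_le (hn : 0 < n) (hγ0 : 0 < γ) (hγ1 : γ ≤ 1)
    (hK : IsNormalisedKernel n γ K) {θ : Fin n → Bool} (hθ : θ ≠ fun _ => false)
    (s : ℕ) (k : ℤ) (mI m : Fin n → ℤ)
    (hsum : Summable fun t : ℕ => coeffBd n γ (t + 1) (s + (t + 1)) m) :
    |pairing (haarFn n k (mI + m) θ) (PsiOp n K s (haarFn n k mI fun _ => false))| ≤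
      2 * 2 ^ n * oscConst n * ∑' t : ℕ, coeffBd n γ (t + 1) (s + (t + 1)) m := by
  set f := haarFn n k mI fun _ => false with hf
  set q := cubeCenter n k (mI + m) with hq
  set A := haarAmp n k with hAdef
  have hA : 0 < A := haarAmp_pos n k
  have hC := oscConst_pos n
  set c : ℝ := 2 * 2 ^ n * oscConst n * A with hc
  let ι : ℕ → ℤ := fun t => k - s - (t + 1 : ℕ)
  have hι : Function.Injective ι := fun a b hab => by simp only [ι] at hab; omega
  let g : ℤ → ℝ := fun j =>
    if j < k - s then c * coeffBd n γ (k - s - j).toNat (s + (k - s - j).toNat) m else 0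
  have hgι : ∀ t, g (ι t) = c * coeffBd n γ (t + 1) (s + (t + 1)) m := by
    intro t
    have h1 : (k - s - ι t).toNat = t + 1 := by simp only [ι]; omega
    have h2 : ι t < k - s := by simp only [ι]; omega
    simp only [g, h1, if_pos h2]
  have hg0 : ∀ j ∉ Set.range ι, g j = 0 := by
    intro j hj
    refine if_neg fun h => hj ⟨(k - s - j).toNat - 1, ?_⟩
    simp only [ι]; omega
  have hgsum : Summable g := by
    rw [← hι.summable_iff hg0]
    exact (hsum.mul_left c).congr fun t => (hgι t).symm
  have hgtsum : ∑' j, g j = c * ∑' t : ℕ, coeffBd n γ (t + 1) (s + (t + 1)) m := by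
    rw [← hι.tsum_eq (f := g) fun j hj => by
      by_contra h; exact hj (hg0 j h), ← tsum_mul_left]
    exact tsum_congr hgι
  have hosc : ∀ x, cellIdx k x = mI + m → |PsiOp n K s f x - PsiOp n K s f q| ≤
      c * ∑' t : ℕ, coeffBd n γ (t + 1) (s + (t + 1)) m := by
    intro x hx
    rw [← hgtsum]
    refine abs_tsum_sub_tsum_le hgsum fun j => ?_
    by_cases hj : j < k - s
    · simp only [g, if_pos hj]
      obtain ⟨t, ht⟩ : ∃ t : ℕ, t = (k - s - j).toNat := ⟨_, rfl⟩
      have ht0 : 0 < t := by omega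
      have hjt : j = k - ((s + t : ℕ) : ℤ) := by push_cast; omega
      have hE : dyadicE n j (czTrunc K (4 * (2:ℝ) ^ (-j)) (dyadicD n (j + (s:ℤ)) f)) x =
          dyadicE n j (czTrunc K (4 * (2:ℝ) ^ (-j)) (dyadicD n (j + (s:ℤ)) f)) q := by
        refine dyadicE_congr _ (cellIdx_eq_of_le (j := k) (by omega) ?_)
        rw [hx, hq, cellIdx_cubeCenter]
      rw [hE, sub_sub_sub_cancel_right, ← ht]
      have h := abs_czTrunc_dyadicD_sub_le hn hγ0 hγ1 hK (fun _ => false) s t k mI m hx ht0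
      have e1 : j + (s:ℤ) = k - t := by omega
      have e2 : (2:ℝ) ^ (-j) = 2 ^ (s + t) * 2 ^ (-k) := by rw [hjt, zpow_neg_sub_natCast]
      rw [e1, e2]
      exact h
    · simp only [g, if_neg hj]
      rw [hf, dyadicD_haarFn_false_of_le (by omega), czTrunc_zero, dyadicE_zero]
      simp
  have hS : 0 ≤ ∑' t : ℕ, coeffBd n γ (t + 1) (s + (t + 1)) m :=
    tsum_nonneg fun t => coeffBd_nonneg _ _ _ _ _
  have h := abs_integral_mul_le_of_integral_eq_zero
    (integrable_haarFn (n := n) (k := k) (m := mI + m) (η := θ))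
    (integral_haarFn_eq_zero hθ) (F := PsiOp n K s f) (c := PsiOp n K s f q)
    (M := c * ∑' t : ℕ, coeffBd n γ (t + 1) (s + (t + 1)) m) (by positivity)
    fun x hx => hosc x (haarFn_ne_zero hx)
  refine h.trans ((mul_le_mul_of_nonneg_left integral_abs_haarFn_le (by positivity)).trans
    (le_of_eq ?_))
  have hAA := haarAmp_mul_haarAmp n k
  rw [← hAdef] at hAA ⊢
  calc c * (∑' t : ℕ, coeffBd n γ (t + 1) (s + (t + 1)) m) * (A * ((2:ℝ) ^ (-k)) ^ n)
      = 2 * 2 ^ n * oscConst n * (∑' t : ℕ, coeffBd n γ (t + 1) (s + (t + 1)) m) *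
        (A * A * ((2:ℝ) ^ (-k)) ^ n) := by rw [hc]; ring
    _ = _ := by rw [hAA, mul_one]

end Coefficients

lemma summable_scale_weights {γ : ℝ} (hγ : 0 < γ) :
    Summable fun t : ℕ => ((t:ℝ) + 2) * ((2:ℝ) ^ (t + 1)) ^ (-γ) := by
  set r : ℝ := (2:ℝ) ^ (-γ) with hr
  have hr0 : 0 < r := by positivity
  have hr1 : r < 1 := Real.rpow_lt_one_of_one_lt_of_neg (by norm_num) (by linarith)
  have hrn : ‖r‖ < 1 := by rwa [Real.norm_of_nonneg hr0.le]
  have h1 := summable_pow_mul_geometric_of_norm_lt_one 1 hrn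
  have h2 := summable_geometric_of_norm_lt_one hrn
  refine ((h1.add (h2.mul_left 2)).mul_left r).congr fun t => ?_
  have : ((2:ℝ) ^ (t + 1)) ^ (-γ) = r ^ (t + 1) := by
    rw [hr, ← Real.rpow_natCast, ← Real.rpow_natCast, ← Real.rpow_mul (by norm_num),
      ← Real.rpow_mul (by norm_num), mul_comm]
  rw [this]
  ring

lemma scale_weight_le {γ : ℝ} (s t : ℕ) :
    (1 + ((s + (t + 1) : ℕ) : ℝ)) * ((2:ℝ) ^ (s + (t + 1))) ^ (-γ) ≤
      (1 + (s:ℝ)) * ((2:ℝ) ^ s) ^ (-γ) * (((t:ℝ) + 2) * ((2:ℝ) ^ (t + 1)) ^ (-γ)) := by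
  rw [pow_add, Real.mul_rpow (by positivity) (by positivity)]
  have h : (1 + ((s + (t + 1) : ℕ) : ℝ)) ≤ (1 + (s:ℝ)) * ((t:ℝ) + 2) := by
    push_cast
    have : (0:ℝ) ≤ (s:ℝ) * t := by positivity
    nlinarith [(Nat.cast_nonneg s : (0:ℝ) ≤ s)]
  calc _ ≤ (1 + (s:ℝ)) * ((t:ℝ) + 2) * (((2:ℝ) ^ s) ^ (-γ) * ((2:ℝ) ^ (t + 1)) ^ (-γ)) := by
        gcongr
    _ = _ := by ring

/-- The estimates (5.10), (5.11), (5.12): the Haar coefficients of `Ψ_s` satisfy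
Figiel's condition with constant `≲ (1+s) 2^{-sγ}`. -/
theorem statement17 (n : ℕ) (hn : 0 < n) (γ : ℝ) (hγ0 : 0 < γ) (hγ1 : γ ≤ 1) :
    ∃ C : ℝ, 0 < C ∧
      ∀ K : (Fin n → ℝ) → (Fin n → ℝ) → ℝ, IsNormalisedKernel n γ K →
      ∀ s : ℕ,
      ∀ θ ζ : Fin n → Bool, ¬(θ = (fun _ => false) ∧ ζ = (fun _ => false)) →
        ∃ B : (Fin n → ℤ) → ℝ,
          (∀ (m : Fin n → ℤ) (k : ℤ) (mI : Fin n → ℤ),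
            |pairing (haarFn n k (mI + m) θ) (PsiOp n K s (haarFn n k mI ζ))| ≤ B m) ∧
          Summable (fun m : Fin n → ℤ => B m * Real.log (2 + inorm m)) ∧
          (∑' m : Fin n → ℤ, B m * Real.log (2 + inorm m)) ≤
            C * (1 + (s:ℝ)) * (2:ℝ) ^ (-(s:ℝ) * γ) := by
  obtain ⟨C₁, hC₁, hsum⟩ := sum_coeffBd_log_le hn hγ0 hγ1
  have hO := oscConst_pos n
  set w : ℕ → ℝ := fun t => ((t:ℝ) + 2) * ((2:ℝ) ^ (t + 1)) ^ (-γ) with hw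
  have hwsum : Summable w := summable_scale_weights hγ0
  have hw0 : 0 ≤ ∑' t, w t := tsum_nonneg fun t => by simp only [hw]; positivity
  have hlog : ∀ m : Fin n → ℤ, 0 < Real.log (2 + inorm m) := fun m =>
    Real.log_pos (by linarith [inorm_nonneg m])
  refine ⟨2 * oscConst n * C₁ + 2 * 2 ^ n * oscConst n * (C₁ * ∑' t, w t), by positivity,
    fun K hK s θ ζ hθζ => ?_⟩
  set W : ℝ := (1 + (s:ℝ)) * ((2:ℝ) ^ s) ^ (-γ) with hWdef
  have hW0 : 0 ≤ W := by positivity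
  have hWe : ∀ C : ℝ, C * (1 + (s:ℝ)) * (2:ℝ) ^ (-(s:ℝ) * γ) = C * W := by
    intro C
    have : (2:ℝ) ^ (-(s:ℝ) * γ) = ((2:ℝ) ^ s) ^ (-γ) := by
      rw [← Real.rpow_natCast, ← Real.rpow_mul (by norm_num)]
      congr 1; ring
    rw [this, hWdef, mul_assoc]
  rw [hWe]
  have finish : ∀ B : (Fin n → ℤ) → ℝ, (∀ m, 0 ≤ B m) → ∀ M : ℝ,
      (∀ F : Finset (Fin n → ℤ), ∑ m ∈ F, B m * Real.log (2 + inorm m) ≤ M) →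
      Summable (fun m => B m * Real.log (2 + inorm m)) ∧
      ∑' m, B m * Real.log (2 + inorm m) ≤ M := fun B hB M hM =>
    have h0 : 0 ≤ fun m => B m * Real.log (2 + inorm m) := fun m => mul_nonneg (hB m) (hlog m).le
    ⟨summable_of_sum_le h0 hM, Real.tsum_le_of_sum_le h0 hM⟩
  by_cases hζ : ζ = fun _ => false
  · have hθ : θ ≠ fun _ => false := fun h => hθζ ⟨h, hζ⟩
    subst hζ
    have hle : ∀ t, C₁ * ((1 + ((s + (t + 1) : ℕ) : ℝ)) * ((2:ℝ) ^ (s + (t + 1))) ^ (-γ)) ≤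
        C₁ * W * w t := fun t => by
      rw [mul_assoc]
      exact mul_le_mul_of_nonneg_left (scale_weight_le s t) hC₁.le
    have hF : ∀ (F : Finset (Fin n → ℤ)) (t : ℕ),
        ∑ m ∈ F, coeffBd n γ (t + 1) (s + (t + 1)) m * Real.log (2 + inorm m) ≤
          C₁ * W * w t := fun F t => (hsum _ _ (Nat.le_add_left _ _) F).trans (hle t)
    have hs' : ∀ m, Summable fun t : ℕ =>
        coeffBd n γ (t + 1) (s + (t + 1)) m * Real.log (2 + inorm m) := fun m =>
      Summable.of_nonneg_of_le (fun t => mul_nonneg (coeffBd_nonneg _ _ _ _ _) (hlog m).le)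
        (fun t => by simpa using hF {m} t) (hwsum.mul_left (C₁ * W))
    have hs : ∀ m, Summable fun t : ℕ => coeffBd n γ (t + 1) (s + (t + 1)) m := fun m =>
      (summable_mul_right_iff (hlog m).ne').1 (hs' m)
    refine ⟨fun m => 2 * 2 ^ n * oscConst n * ∑' t : ℕ, coeffBd n γ (t + 1) (s + (t + 1)) m,
      fun m k mI => abs_pairing_PsiOp_haarFn_false_le hn hγ0 hγ1 hK hθ s k mI m (hs m),
      finish _ (fun m => ?_) _ fun F => ?_⟩
    · have : 0 ≤ ∑' t : ℕ, coeffBd n γ (t + 1) (s + (t + 1)) m :=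
        tsum_nonneg fun t => coeffBd_nonneg _ _ _ _ _
      positivity
    · calc ∑ m ∈ F, 2 * 2 ^ n * oscConst n * (∑' t : ℕ, coeffBd n γ (t + 1) (s + (t + 1)) m) *
            Real.log (2 + inorm m)
          = 2 * 2 ^ n * oscConst n * ∑' t : ℕ, ∑ m ∈ F,
              coeffBd n γ (t + 1) (s + (t + 1)) m * Real.log (2 + inorm m) := by
            rw [Summable.tsum_finsetSum fun m _ => hs' m, Finset.mul_sum]
            refine Finset.sum_congr rfl fun m _ => ?_
            rw [tsum_mul_right, mul_assoc]
        _ ≤ 2 * 2 ^ n * oscConst n * ∑' t : ℕ, C₁ * W * w t := by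
            refine mul_le_mul_of_nonneg_left ?_ (by positivity)
            exact Summable.tsum_le_tsum (hF F) (summable_sum fun m _ => hs' m)
              (hwsum.mul_left (C₁ * W))
        _ = 2 * 2 ^ n * oscConst n * (C₁ * ∑' t, w t) * W := by rw [tsum_mul_left]; ring
        _ ≤ _ := mul_le_mul_of_nonneg_right (le_add_of_nonneg_left (by positivity)) hW0
  · refine ⟨fun m => oscConst n * (coeffBd n γ 0 s m + coeffBd n γ s s m),
      fun m k mI => abs_pairing_PsiOp_haarFn_le hn hγ0 hγ1 hK θ hζ s k mI m,
      finish _ (fun m => ?_) _ fun F => ?_⟩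
    · exact mul_nonneg hO.le (add_nonneg (coeffBd_nonneg _ _ _ _ _) (coeffBd_nonneg _ _ _ _ _))
    · have h1 := hsum 0 s (Nat.zero_le s) F
      have h2 := hsum s s le_rfl F
      calc ∑ m ∈ F, oscConst n * (coeffBd n γ 0 s m + coeffBd n γ s s m) *
            Real.log (2 + inorm m)
          = oscConst n * (∑ m ∈ F, coeffBd n γ 0 s m * Real.log (2 + inorm m) +
              ∑ m ∈ F, coeffBd n γ s s m * Real.log (2 + inorm m)) := by
            rw [← Finset.sum_add_distrib, Finset.mul_sum]
            exact Finset.sum_congr rfl fun m _ => by ring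
        _ ≤ oscConst n * (C₁ * W + C₁ * W) := by gcongr
        _ = 2 * oscConst n * C₁ * W := by ring
        _ ≤ _ := mul_le_mul_of_nonneg_right (le_add_of_nonneg_right (by positivity)) hW0

end
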